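/- arXiv:0809.3286 — 6 statements merged into one kernel-verified Lean document; each statement's English description precedes it below -/
import Mathlib

section
/- Let Γ be an infinite group generated by a finite symmetric set S, equipped with the word metric. Then the fundamental class [Γ] vanishes in H_0^{lin}(Γ): there exist a constant K > 0 and a function ψ : Γ × Γ → ℝ satisfying ψ(x,y) = −ψ(y,x) for all x, y, ψ(x,y) = 0 whenever d(x,y) > 1, |ψ(x,y)| ≤ K·(1 + max(|x|,|y|)) for all x, y, and ∑_{y ∈ Γ} ψ(y,x) = 1 for every x ∈ Γ (the sum having finitely many nonzero terms). -/
/-- Word length of `γ` with respect to a generating set `S`. -/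
noncomputable def wLen {Γ : Type*} [Group Γ] (S : Set Γ) (γ : Γ) : ℕ :=
  sInf {n | ∃ l : List Γ, (∀ s ∈ l, s ∈ S) ∧ l.length = n ∧ l.prod = γ}

/-- The left-invariant word metric `d(x,y) = |x⁻¹y|`. -/
noncomputable def wDist {Γ : Type*} [Group Γ] (S : Set Γ) (x y : Γ) : ℕ :=
  wLen S (x⁻¹ * y)

open Filter

section WordMetric

variable {Γ : Type*} [Group Γ] {S : Set Γ}

theorem exists_list_prod_eq_of_closure_eq_top (hsym : ∀ s ∈ S, s⁻¹ ∈ S)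
    (hgen : Subgroup.closure S = ⊤) (γ : Γ) :
    ∃ l : List Γ, (∀ s ∈ l, s ∈ S) ∧ l.prod = γ := by
  have hγ : γ ∈ (Subgroup.closure S).toSubmonoid := by
    rw [hgen]
    trivial
  rw [Subgroup.closure_toSubmonoid] at hγ
  obtain ⟨l, hl, hprod⟩ := Submonoid.exists_list_of_mem_closure hγ
  refine ⟨l, fun s hs => ?_, hprod⟩
  rcases hl s hs with h | h
  · exact h
  · simpa using hsym _ h

theorem wLen_prod_le {l : List Γ} (hl : ∀ s ∈ l, s ∈ S) : wLen S l.prod ≤ l.length :=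
  Nat.sInf_le ⟨l, hl, rfl, rfl⟩

theorem exists_list_length_eq_wLen
    (hS : ∀ γ : Γ, ∃ l : List Γ, (∀ s ∈ l, s ∈ S) ∧ l.prod = γ) (γ : Γ) :
    ∃ l : List Γ, (∀ s ∈ l, s ∈ S) ∧ l.length = wLen S γ ∧ l.prod = γ := by
  obtain ⟨l, hl, hprod⟩ := hS γ
  exact Nat.sInf_mem (s := {n | ∃ l : List Γ, (∀ s ∈ l, s ∈ S) ∧ l.length = n ∧ l.prod = γ})
    ⟨l.length, l, hl, rfl, hprod⟩

theorem wLen_mul_le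
    (hS : ∀ γ : Γ, ∃ l : List Γ, (∀ s ∈ l, s ∈ S) ∧ l.prod = γ) (a b : Γ) :
    wLen S (a * b) ≤ wLen S a + wLen S b := by
  obtain ⟨l, hl, hlen, rfl⟩ := exists_list_length_eq_wLen hS a
  obtain ⟨m, hm, hmlen, rfl⟩ := exists_list_length_eq_wLen hS b
  rw [← hlen, ← hmlen, ← List.prod_append, ← List.length_append]
  refine wLen_prod_le fun s hs => ?_
  rcases List.mem_append.1 hs with h | h
  exacts [hl s h, hm s h]

theorem wLen_inv_le (hsym : ∀ s ∈ S, s⁻¹ ∈ S)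
    (hS : ∀ γ : Γ, ∃ l : List Γ, (∀ s ∈ l, s ∈ S) ∧ l.prod = γ) (a : Γ) :
    wLen S a⁻¹ ≤ wLen S a := by
  obtain ⟨l, hl, hlen, rfl⟩ := exists_list_length_eq_wLen hS a
  rw [← hlen, List.prod_inv_reverse]
  refine (wLen_prod_le fun s hs => ?_).trans (by simp)
  simp only [List.mem_reverse, List.mem_map] at hs
  obtain ⟨t, ht, rfl⟩ := hs
  exact hsym t (hl t ht)

theorem wDist_comm (hsym : ∀ s ∈ S, s⁻¹ ∈ S)
    (hS : ∀ γ : Γ, ∃ l : List Γ, (∀ s ∈ l, s ∈ S) ∧ l.prod = γ) (x y : Γ) :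
    wDist S x y = wDist S y x := by
  have h (x y : Γ) : wDist S x y ≤ wDist S y x := by
    simpa [wDist] using wLen_inv_le hsym hS (y⁻¹ * x)
  exact le_antisymm (h x y) (h y x)

theorem wDist_le_add_wLen (hsym : ∀ s ∈ S, s⁻¹ ∈ S)
    (hS : ∀ γ : Γ, ∃ l : List Γ, (∀ s ∈ l, s ∈ S) ∧ l.prod = γ) (x y : Γ) :
    wDist S x y ≤ wLen S x + wLen S y :=
  (wLen_mul_le hS _ _).trans (Nat.add_le_add_right (wLen_inv_le hsym hS x) _)

theorem wDist_mul_left (z x y : Γ) : wDist S (z * x) (z * y) = wDist S x y := by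
  simp [wDist, mul_assoc]

theorem finite_wLen_le (hfin : S.Finite)
    (hS : ∀ γ : Γ, ∃ l : List Γ, (∀ s ∈ l, s ∈ S) ∧ l.prod = γ) (n : ℕ) :
    {γ : Γ | wLen S γ ≤ n}.Finite := by
  have : Finite S := hfin
  refine ((List.finite_length_le S n).image fun l => (l.map Subtype.val).prod).subset ?_
  intro γ hγ
  obtain ⟨l, hl, hlen, hprod⟩ := exists_list_length_eq_wLen hS γ
  lift l to List S using hl
  refine ⟨l, ?_, hprod⟩
  simp only [List.length_map] at hlen
  simpa [hlen] using hγ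

theorem exists_lt_wLen [Infinite Γ] (hfin : S.Finite)
    (hS : ∀ γ : Γ, ∃ l : List Γ, (∀ s ∈ l, s ∈ S) ∧ l.prod = γ) (n : ℕ) :
    ∃ γ : Γ, n < wLen S γ := by
  by_contra! h
  exact Set.infinite_univ ((finite_wLen_le hfin hS n).subset fun γ _ => h γ)

/-- The prefixes of a word of minimal length form a geodesic. -/
theorem wDist_prod_take
    (hS : ∀ γ : Γ, ∃ l : List Γ, (∀ s ∈ l, s ∈ S) ∧ l.prod = γ)
    {l : List Γ} (hl : ∀ s ∈ l, s ∈ S) (hlen : l.length = wLen S l.prod)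
    {j k : ℕ} (hjk : j ≤ k) (hk : k ≤ l.length) :
    wDist S (l.take j).prod (l.take k).prod = k - j := by
  have hmid : (l.take k).prod = (l.take j).prod * ((l.drop j).take (k - j)).prod := by
    rw [← List.prod_append, ← List.take_add, Nat.add_sub_cancel' hjk]
  have hd : wDist S (l.take j).prod (l.take k).prod
      = wLen S ((l.drop j).take (k - j)).prod := by
    rw [wDist, hmid, inv_mul_cancel_left]
  rw [hd]
  have h1 : wLen S (l.take j).prod ≤ j :=
    (wLen_prod_le fun s hs => hl s (List.mem_of_mem_take hs)).trans (by simp)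
  have h2 : wLen S ((l.drop j).take (k - j)).prod ≤ k - j :=
    (wLen_prod_le fun s hs => hl s (List.mem_of_mem_drop (List.mem_of_mem_take hs))).trans
      (by simp)
  have h3 : wLen S (l.drop k).prod ≤ l.length - k :=
    (wLen_prod_le fun s hs => hl s (List.mem_of_mem_drop hs)).trans (by simp)
  have h4 := wLen_mul_le hS ((l.take j).prod * ((l.drop j).take (k - j)).prod) (l.drop k).prod
  have h5 := wLen_mul_le hS (l.take j).prod ((l.drop j).take (k - j)).prod
  rw [← hmid, List.prod_take_mul_prod_drop, ← hlen, hmid] at h4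
  omega

theorem exists_geodesic_segment [Infinite Γ] (hsym : ∀ s ∈ S, s⁻¹ ∈ S) (hfin : S.Finite)
    (hS : ∀ γ : Γ, ∃ l : List Γ, (∀ s ∈ l, s ∈ S) ∧ l.prod = γ) (n : ℕ) :
    ∃ g : ℤ → Γ, g 0 = 1 ∧ ∀ i j : ℤ, i.natAbs ≤ n → j.natAbs ≤ n →
      wDist S (g i) (g j) = (i - j).natAbs := by
  obtain ⟨γ, hγ⟩ := exists_lt_wLen hfin hS (2 * n)
  obtain ⟨l, hl, hlen, rfl⟩ := exists_list_length_eq_wLen hS γ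
  refine ⟨fun i => (l.take n).prod⁻¹ * (l.take (n + i).toNat).prod, by simp, ?_⟩
  intro i j hi hj
  rw [wDist_mul_left]
  rcases le_total i j with h | h
  · rw [wDist_prod_take hS hl hlen (by omega) (by omega)]
    omega
  · rw [wDist_comm hsym hS, wDist_prod_take hS hl hlen (by omega) (by omega)]
    omega

/-- An infinite finitely generated group contains a bi-infinite geodesic through the identity. -/
theorem exists_biinfinite_geodesic [Infinite Γ] (hsym : ∀ s ∈ S, s⁻¹ ∈ S) (hfin : S.Finite)
    (hS : ∀ γ : Γ, ∃ l : List Γ, (∀ s ∈ l, s ∈ S) ∧ l.prod = γ) :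
    ∃ g : ℤ → Γ, g 0 = 1 ∧ ∀ i j : ℤ, wDist S (g i) (g j) = (i - j).natAbs := by
  choose c hc0 hc using exists_geodesic_segment hsym hfin hS
  have hU (m : ℕ) : ∀ᶠ n in (hyperfilter ℕ : Filter ℕ), m ≤ n :=
    Nat.hyperfilter_le_atTop (eventually_ge_atTop m)
  have hlim (i : ℤ) : ∃ v : Γ, ∀ᶠ n in (hyperfilter ℕ : Filter ℕ), c n i = v := by
    have hmem : ∀ᶠ n in (hyperfilter ℕ : Filter ℕ),
        ∃ v ∈ {γ : Γ | wLen S γ ≤ i.natAbs}, c n i = v := by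
      filter_upwards [hU i.natAbs] with n hn
      have := hc n 0 i (by simp) hn
      rw [hc0] at this
      exact ⟨_, by simpa [wDist] using this.le, rfl⟩
    obtain ⟨v, -, hv⟩ :=
      (Ultrafilter.eventually_exists_mem_iff (finite_wLen_le hfin hS i.natAbs)).1 hmem
    exact ⟨v, hv⟩
  choose g hg using hlim
  refine ⟨g, ?_, fun i j => ?_⟩
  · obtain ⟨n, hn⟩ := (hg 0).exists
    rw [← hn, hc0]
  · obtain ⟨n, hi, hj, hni, hnj⟩ :=
      ((hg i).and ((hg j).and ((hU i.natAbs).and (hU j.natAbs)))).exists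
    rw [← hi, ← hj, hc n i j hni hnj]

/-- One of the two halves of a bi-infinite geodesic, translated by `z`, escapes from the identity
at linear speed. -/
theorem exists_escaping_half (hsym : ∀ s ∈ S, s⁻¹ ∈ S)
    (hS : ∀ γ : Γ, ∃ l : List Γ, (∀ s ∈ l, s ∈ S) ∧ l.prod = γ)
    {g : ℤ → Γ} (hg : ∀ i j : ℤ, wDist S (g i) (g j) = (i - j).natAbs) (z : Γ) :
    ∃ σ : ℤˣ, ∀ i : ℕ, i ≤ wLen S (z * g (σ * i)) := by
  by_contra! h
  obtain ⟨i, hi⟩ := h 1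
  obtain ⟨j, hj⟩ := h (-1)
  have hd := wDist_le_add_wLen hsym hS (z * g ((1 : ℤˣ) * i)) (z * g ((-1 : ℤˣ) * j))
  rw [wDist_mul_left, hg] at hd
  simp only [Units.val_one, Units.val_neg, one_mul, neg_mul] at hd hi hj
  omega

/-- A family of rays `r z` starting at `z`, with unit steps, such that at most `2 (1 + |x|)` of
the points of all these rays coincide with any given `x`. -/
theorem exists_sparse_rays [Infinite Γ] (hsym : ∀ s ∈ S, s⁻¹ ∈ S) (hfin : S.Finite)
    (hS : ∀ γ : Γ, ∃ l : List Γ, (∀ s ∈ l, s ∈ S) ∧ l.prod = γ) :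
    ∃ (r : Γ → ℕ → Γ) (F : Γ → Finset (Γ × ℕ)), (∀ z, r z 0 = z) ∧
      (∀ z i, wDist S (r z i) (r z (i + 1)) = 1) ∧
      (∀ x p, p ∈ F x ↔ r p.1 p.2 = x) ∧
      ∀ x, (F x).card ≤ 2 * (1 + wLen S x) := by
  obtain ⟨g, hg0, hg⟩ := exists_biinfinite_geodesic hsym hfin hS
  choose σ hσ using exists_escaping_half hsym hS hg
  have hmaps (x : Γ) : Set.MapsTo (fun p : Γ × ℕ => (σ p.1, p.2))
      {p | p.1 * g (σ p.1 * p.2) = x}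
      ((Finset.univ ×ˢ Finset.range (1 + wLen S x) : Finset (ℤˣ × ℕ)) : Set (ℤˣ × ℕ)) := by
    rintro ⟨z, i⟩ rfl
    simp [Nat.lt_one_add_iff, hσ z i, Int.units_eq_one_or]
  have hinj (x : Γ) : Set.InjOn (fun p : Γ × ℕ => (σ p.1, p.2))
      {p | p.1 * g (σ p.1 * p.2) = x} := by
    rintro ⟨z, i⟩ rfl ⟨w, j⟩ hw h
    simp only [Prod.mk.injEq, Set.mem_ofPred_eq] at h hw
    obtain ⟨h1, rfl⟩ := h
    rw [h1] at hw
    rw [mul_right_cancel hw]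
  have hF (x : Γ) : {p : Γ × ℕ | p.1 * g (σ p.1 * p.2) = x}.Finite :=
    Set.Finite.of_injOn (hmaps x) (hinj x) (Finset.finite_toSet _)
  refine ⟨fun z i => z * g (σ z * i), fun x => (hF x).toFinset, fun z => by simp [hg0],
    fun z i => ?_, fun x p => by simp, fun x => ?_⟩
  · rw [wDist_mul_left, hg, ← mul_sub, Int.natAbs_mul, Int.units_natAbs]
    simp
  · have hle := Finset.card_le_card_of_injOn (s := (hF x).toFinset)
      (t := Finset.univ ×ˢ Finset.range (1 + wLen S x)) (fun p => (σ p.1, p.2))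
      (by rw [Set.Finite.coe_toFinset]; exact hmaps x)
      (by rw [Set.Finite.coe_toFinset]; exact hinj x)
    simpa [Finset.card_product] using hle

end WordMetric

section RayFlow

open Classical in
/-- The number of steps from `x` to `y` made by the rays `r`, where `F x` is the finite
set of pairs `(z, i)` with `r z i = x`. -/
noncomputable def stepCount {V : Type*} (r : V → ℕ → V) (F : V → Finset (V × ℕ)) (x y : V) : ℕ :=
  ((F x).filter fun p => r p.1 (p.2 + 1) = y).card

variable {V : Type*} {r : V → ℕ → V} {F : V → Finset (V × ℕ)}

theorem stepCount_le_card (x y : V) : stepCount r F x y ≤ (F x).card := by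
  classical exact Finset.card_le_card (Finset.filter_subset _ _)

theorem exists_step_of_stepCount_ne_zero (hF : ∀ x p, p ∈ F x ↔ r p.1 p.2 = x) {x y : V}
    (h : stepCount r F x y ≠ 0) : ∃ z i, r z i = x ∧ r z (i + 1) = y := by
  classical
  obtain ⟨p, hp⟩ := Finset.card_ne_zero.1 h
  rw [Finset.mem_filter, hF] at hp
  exact ⟨p.1, p.2, hp⟩

open Classical in
theorem stepCount_eq_card_arrivals (hF : ∀ x p, p ∈ F x ↔ r p.1 p.2 = x) (x y : V) :
    stepCount r F y x
      = (((F x).erase (x, 0)).filter fun p => p.2 ≠ 0 ∧ r p.1 (p.2 - 1) = y).card := by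
  refine Finset.card_bij' (fun p _ => (p.1, p.2 + 1)) (fun p _ => (p.1, p.2 - 1)) ?_ ?_ ?_ ?_
  · rintro ⟨z, i⟩ h
    simp_all
  · rintro ⟨z, _ | i⟩ h <;> simp_all
  · rintro ⟨z, i⟩ h
    simp
  · rintro ⟨z, _ | i⟩ h <;> simp_all

open Classical in
theorem exists_finset_sum_stepCount (h0 : ∀ z, r z 0 = z)
    (hF : ∀ x p, p ∈ F x ↔ r p.1 p.2 = x) (x : V) :
    ∃ T : Finset V, (∀ y ∉ T, stepCount r F x y = 0 ∧ stepCount r F y x = 0) ∧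
      ∑ y ∈ T, stepCount r F x y = ∑ y ∈ T, stepCount r F y x + 1 := by
  let T : Finset V := (F x).image (fun p => r p.1 (p.2 + 1)) ∪
    (F x).image (fun p => r p.1 (p.2 - 1))
  have hsucc : ∀ p ∈ F x, r p.1 (p.2 + 1) ∈ T := fun p hp =>
    Finset.mem_union_left _ (Finset.mem_image_of_mem (fun p : V × ℕ => r p.1 (p.2 + 1)) hp)
  have hpred : ∀ p ∈ F x, r p.1 (p.2 - 1) ∈ T := fun p hp =>
    Finset.mem_union_right _ (Finset.mem_image_of_mem (fun p : V × ℕ => r p.1 (p.2 - 1)) hp)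
  refine ⟨T, fun y hy => ⟨?_, ?_⟩, ?_⟩
  · by_contra h
    obtain ⟨z, i, hx, rfl⟩ := exists_step_of_stepCount_ne_zero hF h
    exact hy (hsucc (z, i) ((hF _ _).2 hx))
  · by_contra h
    obtain ⟨z, i, rfl, hx⟩ := exists_step_of_stepCount_ne_zero hF h
    exact hy (hpred (z, i + 1) ((hF _ _).2 hx))
  · have hout : ∑ y ∈ T, stepCount r F x y = (F x).card :=
      (Finset.card_eq_sum_card_fiberwise hsucc).symm
    have hne : ∀ p ∈ (F x).erase (x, 0), p.2 ≠ 0 := by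
      rintro ⟨z, i⟩ hp rfl
      simp_all
    have hin : ∑ y ∈ T, stepCount r F y x = ((F x).erase (x, 0)).card := by
      rw [Finset.card_eq_sum_card_fiberwise (f := fun p => r p.1 (p.2 - 1)) (t := T)
        fun p hp => hpred p (Finset.mem_of_mem_erase hp)]
      refine Finset.sum_congr rfl fun y _ => ?_
      rw [stepCount_eq_card_arrivals hF]
      congr 1
      refine Finset.filter_congr fun p hp => ?_
      simp [hne p hp]
    rw [hout, hin, Finset.card_erase_add_one ((hF _ _).2 (h0 x))]

end RayFlow

/-- For every infinite finitely generated group, the fundamental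
class vanishes in `H_0^{lin}`: there is a linearly controlled 1-chain of
propagation `≤ 1` whose boundary is the constant function `1`. -/
theorem vanishing_of_fundamental_class_linear_control
    {Γ : Type*} [Group Γ] [Infinite Γ] (S : Finset Γ)
    (hsym : ∀ s ∈ S, s⁻¹ ∈ S)
    (hgen : Subgroup.closure (S : Set Γ) = ⊤) :
    ∃ K > (0:ℝ), ∃ ψ : Γ → Γ → ℝ,
      (∀ x y, ψ x y = - ψ y x) ∧
      (∀ x y, 1 < wDist (S : Set Γ) x y → ψ x y = 0) ∧
      (∀ x y, |ψ x y| ≤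
        K * (1 + ((max (wLen (S : Set Γ) x) (wLen (S : Set Γ) y) : ℕ) : ℝ))) ∧
      (∀ x : Γ, {y : Γ | ψ y x ≠ 0}.Finite) ∧
      (∀ x : Γ, ∑ᶠ y : Γ, ψ y x = 1) := by
  have hS := exists_list_prod_eq_of_closure_eq_top hsym hgen
  obtain ⟨r, F, h0, hstep, hF, hcard⟩ := exists_sparse_rays hsym S.finite_toSet hS
  have hprop (x y : Γ) (h : 1 < wDist (S : Set Γ) x y) : stepCount r F x y = 0 := by
    by_contra hne
    obtain ⟨z, i, rfl, rfl⟩ := exists_step_of_stepCount_ne_zero hF hne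
    exact h.ne' (hstep z i)
  have hbound (x y : Γ) : (stepCount r F x y : ℝ) ≤ 2 * (1 + (wLen (S : Set Γ) x : ℝ)) := by
    exact_mod_cast (stepCount_le_card x y).trans (hcard x)
  have hsum (x : Γ) : ∃ T : Finset Γ,
      (Function.support fun y => (stepCount r F x y : ℝ) - stepCount r F y x) ⊆ T ∧
      ∑ y ∈ T, ((stepCount r F x y : ℝ) - stepCount r F y x) = 1 := by
    obtain ⟨T, hT, hTsum⟩ := exists_finset_sum_stepCount h0 hF x
    refine ⟨T, fun y hy => ?_, ?_⟩
    · by_contra hyT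
      exact hy (by simp [hT y hyT])
    · rw [Finset.sum_sub_distrib, sub_eq_iff_eq_add']
      exact_mod_cast hTsum
  refine ⟨2, two_pos, fun y x => (stepCount r F x y : ℝ) - stepCount r F y x,
    fun x y => by ring, fun x y h => ?_, fun x y => ?_, fun x => ?_, fun x => ?_⟩
  · simp [hprop x y h, hprop y x (by rwa [wDist_comm hsym hS])]
  · have hx := hbound x y
    have hy := hbound y x
    have hx0 : (0 : ℝ) ≤ stepCount r F x y := Nat.cast_nonneg _
    have hy0 : (0 : ℝ) ≤ stepCount r F y x := Nat.cast_nonneg _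
    rw [Nat.cast_max, abs_le]
    have hmx := le_max_left (wLen (S : Set Γ) x : ℝ) (wLen (S : Set Γ) y)
    have hmy := le_max_right (wLen (S : Set Γ) x : ℝ) (wLen (S : Set Γ) y)
    constructor <;> linarith
  · obtain ⟨T, hT, -⟩ := hsum x
    exact T.finite_toSet.subset hT
  · obtain ⟨T, hT, hTsum⟩ := hsum x
    rw [finsum_eq_sum_of_support_subset _ hT, hTsum]
end

section
/- Let X be a uniformly discrete, bounded geometry, quasi-geodesic metric space and let f be a control function. Then X satisfies the isoperimetric inequality (I^f_∂) if and only if the fundamental class [X] vanishes in H_0^f(X), i.e. if and only if there exists an f-controlled 1-chain ψ on X with ∂ψ(x) = 1 for every x ∈ X. -/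
/-- A metric space is uniformly discrete if distinct points are uniformly separated. -/
def UnifDiscrete (X : Type*) [MetricSpace X] : Prop :=
  ∃ c > (0:ℝ), ∀ x y : X, x ≠ y → c ≤ dist x y

/-- A metric space has bounded geometry if balls of each radius have uniformly
bounded (finite) cardinality. -/
def BddGeom (X : Type*) [MetricSpace X] : Prop :=
  ∀ r > (0:ℝ), ∃ N : ℕ, ∀ x : X,
    (Metric.closedBall x r).Finite ∧ (Metric.closedBall x r).ncard ≤ N

/-- Quasi-geodesic: any two points are joined by a chain of `≤ d(x,y)` unit steps. -/
def QuasiGeodesic (X : Type*) [MetricSpace X] : Prop :=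
  ∀ x y : X, ∃ n : ℕ, ∃ p : ℕ → X,
    p 0 = x ∧ p n = y ∧ (∀ i < n, dist (p i) (p (i + 1)) ≤ 1) ∧ (n : ℝ) ≤ dist x y

/-- A control function: non-decreasing, nonnegative on `[0,∞)`, `f 0 = 1`, with
controlled behaviour under additive shifts and multiplicative rescalings. -/
structure IsControlFun (f : ℝ → ℝ) : Prop where
  nonneg : ∀ t : ℝ, 0 ≤ t → 0 ≤ f t
  mono : ∀ s t : ℝ, 0 ≤ s → s ≤ t → f s ≤ f t
  one_at_zero : f 0 = 1
  shift : ∀ K > (0:ℝ), ∃ L > (0:ℝ), ∀ t > (0:ℝ), f (t + K) ≤ L * f t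
  scale : ∀ K > (0:ℝ), ∃ L > (0:ℝ), ∀ t > (0:ℝ), f (K * t) ≤ L * f t

/-- An `f`-controlled 1-chain on `X` with basepoint `e`: antisymmetric, of finite
propagation, with coefficients bounded by a multiple of `f (max |x| |y|)`. -/
structure IsCtrlChain {X : Type*} [MetricSpace X] (e : X) (f : ℝ → ℝ) (ψ : X → X → ℝ) : Prop where
  antisymm : ∀ x y, ψ x y = - ψ y x
  finprop : ∃ R > (0:ℝ), ∀ x y, R < dist x y → ψ x y = 0
  bound : ∃ K > (0:ℝ), ∀ x y, |ψ x y| ≤ K * f (max (dist x e) (dist y e))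

/-- The boundary `∂A` of a set: points at distance `≤ 1` both from `A` and from its
complement. -/
def isoBdry {X : Type*} [MetricSpace X] (A : Set X) : Set X :=
  {x | (∃ a ∈ A, dist x a ≤ 1) ∧ (∃ b ∈ Aᶜ, dist x b ≤ 1)}

/-- The isoperimetric inequality `(I^f_∂)`:  `#A ≤ C · ∑_{x ∈ ∂A} f(|x|)` for all
finite `A ⊆ X`. -/
def SatIso {X : Type*} [MetricSpace X] (e : X) (f : ℝ → ℝ) : Prop :=
  ∃ C > (0:ℝ), ∀ A : Finset X,
    (A.card : ℝ) ≤ C * ∑ᶠ x ∈ isoBdry (A : Set X), f (dist x e)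

open Finset in
/-- **Max-flow min-cut** for a locally finite directed multigraph with edge type `T`: if every finite
set `A` of vertices has at least `#A` edges entering it from outside, then there is a set of
edges whose indegree exceeds its outdegree by exactly one at every vertex. -/
theorem exists_edges_indegree_eq_outdegree_add_one {X T : Type*} [DecidableEq X] [DecidableEq T]
    (src tgt : T → X) (out inn : X → Finset T)
    (hout : ∀ x τ, τ ∈ out x ↔ src τ = x) (hinn : ∀ x τ, τ ∈ inn x ↔ tgt τ = x)
    (hcut : ∀ A : Finset X, #A ≤ #(A.biUnion inn \ A.biUnion out)) :
    ∃ (P : T → Prop) (_ : DecidablePred P),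
      ∀ x, #((inn x).filter P) = #((out x).filter P) + 1 := by
  classical
  let v : X ⊕ T → X := Sum.elim id src
  let R : X ⊕ T → T → Prop := fun s τ ↦ τ ∈ out (v s) ∪ inn (v s)
  -- Hall's theorem, applied to slots `X ⊕ T` competing for edges
  obtain ⟨g, hg, hgR⟩ := (Finset.all_card_le_biUnion_card_iff_exists_injective
    (fun s : X ⊕ T ↦ out (v s) ∪ inn (v s))).1 (by
      intro S
      let A := S.image v
      have h1 : S ⊆ A.disjSum (A.biUnion out) := by
        rintro (x | τ) hs
        · rw [inl_mem_disjSum]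
          exact mem_image_of_mem v hs
        · rw [inr_mem_disjSum, mem_biUnion]
          exact ⟨src τ, mem_image_of_mem v hs, (hout _ _).2 rfl⟩
      have h2 : (S.biUnion fun s ↦ out (v s) ∪ inn (v s)) =
          (A.biUnion inn \ A.biUnion out) ∪ A.biUnion out := by
        ext τ
        simp only [A, mem_biUnion, mem_union, mem_image, mem_sdiff]
        grind
      calc #S ≤ #(A.disjSum (A.biUnion out)) := card_le_card h1
        _ = #A + #(A.biUnion out) := card_disjSum _ _
        _ ≤ #(A.biUnion inn \ A.biUnion out) + #(A.biUnion out) := by gcongr; exact hcut A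
        _ = _ := by rw [h2, card_union_of_disjoint sdiff_disjoint])
  obtain ⟨h, hb, hR⟩ := Function.Embedding.schroeder_bernstein_of_rel hg
    (Sum.inr_injective (α := X) (β := T)) R hgR
    (fun τ ↦ mem_union_left _ ((hout _ _).2 rfl))
  let e := Equiv.ofBijective h hb
  let w : T → X := fun τ ↦ v (e.symm τ)
  have hw : ∀ τ, src τ = w τ ∨ tgt τ = w τ := by
    intro τ
    have := hR (e.symm τ)
    rw [show h (e.symm τ) = τ from e.apply_symm_apply τ] at this
    simpa [R, hout, hinn] using this
  refine ⟨fun τ ↦ src τ ≠ w τ, inferInstance, fun x ↦ ?_⟩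
  have hslots : ((out x ∪ inn x).filter fun τ ↦ w τ = x).card = #(out x) + 1 := by
    have : ((out x ∪ inn x).filter fun τ ↦ w τ = x) =
        (({x} : Finset X).disjSum (out x)).map e.toEmbedding := by
      ext τ
      simp only [mem_filter, mem_union, mem_map_equiv, hout, hinn]
      have hτ := hw τ
      have hwv : w τ = v (e.symm τ) := rfl
      rcases hs : e.symm τ with y | σ
      · rw [hs] at hwv
        rw [inl_mem_disjSum, mem_singleton]
        simp only [v, Sum.elim_inl, id] at hwv
        grind
      · rw [hs] at hwv
        rw [inr_mem_disjSum, hout]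
        simp only [v, Sum.elim_inr] at hwv
        grind
    rw [this, card_map, card_disjSum, card_singleton, add_comm]
  have hsplit : #((out x ∪ inn x).filter fun τ ↦ w τ = x) =
      #((inn x).filter fun τ ↦ src τ ≠ w τ) + #((out x).filter fun τ ↦ ¬ src τ ≠ w τ) := by
    rw [← card_union_of_disjoint]
    · congr 1
      ext τ
      simp only [mem_filter, mem_union, hout, hinn]
      have := hw τ
      grind
    · rw [disjoint_left]
      simp only [mem_filter]
      tauto
  have hcompl := card_filter_add_card_filter_not (s := out x) (fun τ ↦ src τ ≠ w τ)
  omega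

/-- In a quasi-geodesic space, a path leaving `A` passes through `isoBdry A`. -/
theorem QuasiGeodesic.exists_mem_isoBdry {X : Type*} [MetricSpace X] (hqg : QuasiGeodesic X)
    {A : Set X} {x y : X} (hx : x ∈ A) (hy : y ∉ A) :
    ∃ z ∈ isoBdry A, dist x z ≤ dist x y ∧ dist z y ≤ dist x y := by
  classical
  obtain ⟨n, p, hp0, hpn, hp, hn⟩ := hqg x y
  have hex : ∃ i, p i ∉ A := ⟨n, hpn ▸ hy⟩
  have hin : Nat.find hex ≤ n := Nat.find_min' hex (hpn ▸ hy)
  have hi := Nat.find_spec hex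
  obtain ⟨k, hk⟩ : ∃ k, Nat.find hex = k + 1 := by
    refine Nat.exists_eq_succ_of_ne_zero fun h0 ↦ hi ?_
    rw [h0, hp0]
    exact hx
  have hkA : p k ∈ A := not_not.1 (Nat.find_min hex (by omega))
  rw [hk] at hi hin
  refine ⟨p k, ⟨⟨p k, hkA, by simp⟩, p (k + 1), hi, hp k (by omega)⟩, ?_, ?_⟩
  · have := dist_le_range_sum_of_dist_le (f := p) k (d := fun _ ↦ 1) fun h ↦ hp _ (by omega)
    rw [hp0] at this
    simp only [Finset.sum_const, Finset.card_range, nsmul_eq_mul, mul_one] at this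
    have : (k : ℝ) ≤ n := by exact_mod_cast (by omega : k ≤ n)
    linarith
  · have := dist_le_Ico_sum_of_dist_le (f := p) (by omega : k ≤ n) (d := fun _ ↦ 1)
      fun _ h ↦ hp _ h
    rw [hpn] at this
    simp only [Finset.sum_const, Nat.card_Ico, nsmul_eq_mul, mul_one] at this
    have : ((n - k : ℕ) : ℝ) ≤ n := by exact_mod_cast Nat.sub_le n k
    linarith

theorem BddGeom.finite_closedBall {X : Type*} [MetricSpace X] (hbg : BddGeom X) (x : X) (r : ℝ) :
    (Metric.closedBall x r).Finite :=
  let ⟨_, hN⟩ := hbg (max r 1) (by positivity)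
  (hN x).1.subset (Metric.closedBall_subset_closedBall (le_max_left _ _))

theorem BddGeom.finite_isoBdry {X : Type*} [MetricSpace X] (hbg : BddGeom X) (A : Finset X) :
    (isoBdry (A : Set X)).Finite := by
  refine (A.finite_toSet.biUnion fun a _ ↦ hbg.finite_closedBall a 1).subset ?_
  rintro x ⟨⟨a, ha, hxa⟩, -⟩
  exact Set.mem_biUnion ha hxa

theorem IsControlFun.exists_add_le {f : ℝ → ℝ} (hf : IsControlFun f) {K : ℝ} (hK : 0 < K) :
    ∃ L > (0 : ℝ), ∀ t, 0 ≤ t → f (t + K) ≤ L * f t := by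
  obtain ⟨L, hL, h⟩ := hf.shift K hK
  refine ⟨max L (f K), lt_max_of_lt_left hL, fun t ht ↦ ?_⟩
  rcases ht.eq_or_lt with rfl | ht'
  · rw [hf.one_at_zero, zero_add, mul_one]
    exact le_max_right _ _
  · exact (h t ht').trans (mul_le_mul_of_nonneg_right (le_max_left _ _) (hf.nonneg t ht))

theorem IsControlFun.one_le {f : ℝ → ℝ} (hf : IsControlFun f) {t : ℝ} (ht : 0 ≤ t) : 1 ≤ f t :=
  hf.one_at_zero ▸ hf.mono 0 t le_rfl ht

open Finset in
/-- The sum of the boundary of a 1-chain over `A` is the flux across the cut `(A, U \ A)`. -/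
theorem sum_sum_eq_sum_sum_sdiff {X : Type*} [DecidableEq X] {ψ : X → X → ℝ}
    (hψ : ∀ x y, ψ x y = -ψ y x) {A U : Finset X} (hAU : A ⊆ U) :
    ∑ x ∈ A, ∑ y ∈ U, ψ y x = ∑ x ∈ A, ∑ y ∈ U \ A, ψ y x := by
  have hA : ∑ x ∈ A, ∑ y ∈ A, ψ y x = 0 := by
    have h1 : ∑ x ∈ A, ∑ y ∈ A, ψ y x = ∑ x ∈ A, ∑ y ∈ A, ψ x y := sum_comm
    have h2 : ∑ x ∈ A, ∑ y ∈ A, ψ y x = -∑ x ∈ A, ∑ y ∈ A, ψ x y := by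
      simp_rw [← sum_neg_distrib]
      exact sum_congr rfl fun x _ ↦ sum_congr rfl fun y _ ↦ hψ y x
    linarith
  simp_rw [← sum_sdiff hAU, sum_add_distrib, hA, add_zero]

open Finset in
theorem satIso_of_chain {X : Type*} [MetricSpace X] {e : X} {f : ℝ → ℝ}
    (hbg : BddGeom X) (hqg : QuasiGeodesic X) (hf : IsControlFun f) {ψ : X → X → ℝ}
    (hψ : IsCtrlChain e f ψ) (hd : ∀ x : X, ∑ᶠ y : X, ψ y x = 1) : SatIso e f := by
  classical
  obtain ⟨R, hR, hprop⟩ := hψ.finprop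
  obtain ⟨K, hK, hbound⟩ := hψ.bound
  obtain ⟨L, hL, hshift⟩ := hf.exists_add_le hR
  obtain ⟨N, hN⟩ := hbg R hR
  let B : X → Finset X := fun x ↦ (hN x).1.toFinset
  have hB : ∀ x y, y ∈ B x ↔ dist y x ≤ R := fun x y ↦ by simp [B]
  have hBN : ∀ x, #(B x) ≤ N := fun x ↦ by
    rw [← Set.ncard_eq_toFinset_card _ (hN x).1]; exact (hN x).2
  refine ⟨K * L * (N * N + 1), by positivity, fun A ↦ ?_⟩
  let D : Finset X := (hbg.finite_isoBdry A).toFinset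
  rw [finsum_mem_eq_finite_toFinset_sum _ (hbg.finite_isoBdry A)]
  let U := A ∪ A.biUnion B
  let P := (A ×ˢ (U \ A)).filter fun p ↦ dist p.1 p.2 ≤ R
  have hP : ∀ p : X × X, ∃ z, p ∈ P → z ∈ D ∧ dist p.1 z ≤ R ∧ dist z p.2 ≤ R := by
    intro p
    by_cases hp : p ∈ P
    · simp only [P, mem_filter, mem_product, mem_sdiff] at hp
      obtain ⟨z, hz, h1, h2⟩ := hqg.exists_mem_isoBdry (A := (A : Set X)) hp.1.1 hp.1.2.2
      exact ⟨z, fun _ ↦ ⟨by simpa [D] using hz, h1.trans hp.2, h2.trans hp.2⟩⟩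
    · exact ⟨p.1, fun h ↦ absurd h hp⟩
  choose z hz using hP
  have hterm : ∀ p ∈ P, ψ p.2 p.1 ≤ K * L * f (dist (z p) e) := by
    intro p hp
    obtain ⟨-, h1, h2⟩ := hz p hp
    have hmax : max (dist p.2 e) (dist p.1 e) ≤ dist (z p) e + R := by
      have := dist_triangle p.1 (z p) e
      have := dist_triangle_left p.2 e (z p)
      have := dist_triangle p.2 (z p) e
      rw [dist_comm p.2 (z p)] at this
      exact max_le (by linarith) (by linarith)
    calc ψ p.2 p.1 ≤ K * f (max (dist p.2 e) (dist p.1 e)) := (le_abs_self _).trans (hbound _ _)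
      _ ≤ K * (L * f (dist (z p) e)) := by
        gcongr
        exact (hf.mono _ _ (by positivity) hmax).trans (hshift _ dist_nonneg)
      _ = _ := by ring
  have hfiber : ∀ w ∈ D, (#(P.filter fun p ↦ z p = w) : ℝ) ≤ N * N + 1 := by
    intro w _
    have hsub : (P.filter fun p ↦ z p = w) ⊆ B w ×ˢ B w := by
      intro p hp
      rw [mem_filter] at hp
      obtain ⟨-, h1, h2⟩ := hz p hp.1
      rw [hp.2] at h1 h2
      rw [mem_product, hB, hB, dist_comm p.2]
      exact ⟨h1, h2⟩
    have h := card_le_card hsub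
    rw [card_product] at h
    have := h.trans (Nat.mul_le_mul (hBN w) (hBN w))
    exact_mod_cast this.trans (Nat.le_succ _)
  calc (#A : ℝ) = ∑ x ∈ A, ∑ y ∈ U, ψ y x := by
        rw [card_eq_sum_ones, Nat.cast_sum, Nat.cast_one]
        refine sum_congr rfl fun x hx ↦ ?_
        rw [← hd x]
        refine finsum_eq_sum_of_support_subset _ fun y hy ↦ ?_
        rw [mem_coe, mem_union, mem_biUnion]
        refine Or.inr ⟨x, hx, (hB _ _).2 (not_lt.1 fun h ↦ hy (hprop _ _ h))⟩
    _ = ∑ x ∈ A, ∑ y ∈ U \ A, ψ y x := sum_sum_eq_sum_sum_sdiff hψ.antisymm subset_union_left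
    _ = ∑ p ∈ P, ψ p.2 p.1 := by
        rw [← sum_product' A (U \ A) fun x y ↦ ψ y x, sum_filter_of_ne]
        intro p _ hp
        rw [dist_comm]
        exact not_lt.1 fun h ↦ hp (hprop _ _ h)
    _ ≤ ∑ p ∈ P, K * L * f (dist (z p) e) := sum_le_sum hterm
    _ = ∑ w ∈ D, #(P.filter fun p ↦ z p = w) * (K * L * f (dist w e)) := by
        rw [← sum_fiberwise_of_maps_to' (t := D) (fun p hp ↦ (hz p hp).1)
          fun w ↦ K * L * f (dist w e)]
        simp
    _ ≤ ∑ w ∈ D, (N * N + 1) * (K * L * f (dist w e)) := by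
        refine sum_le_sum fun w hw ↦ mul_le_mul_of_nonneg_right (hfiber w hw) ?_
        have := hf.nonneg (dist w e) dist_nonneg
        positivity
    _ = _ := by
        rw [mul_sum]
        exact sum_congr rfl fun w _ ↦ by ring

/-- The edges of the multigraph on `X` with `m x + m y` parallel edges from `x` to `y` whenever
`dist x y ≤ 1`. -/
abbrev UnitEdge {X : Type*} [MetricSpace X] (m : X → ℕ) : Type _ :=
  {q : X × X × ℕ // dist q.1 q.2.1 ≤ 1 ∧ q.2.2 < m q.1 + m q.2.1}

namespace UnitEdge

variable {X : Type*} [MetricSpace X] {m : X → ℕ}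

/-- The source of an edge. -/
def src (τ : UnitEdge m) : X := τ.1.1

/-- The target of an edge. -/
def tgt (τ : UnitEdge m) : X := τ.1.2.1

theorem finite_src (hbg : BddGeom X) (x : X) : {τ : UnitEdge m | τ.src = x}.Finite := by
  refine Set.Finite.of_finite_image (f := Subtype.val) ?_ Subtype.val_injective.injOn
  refine ((hbg.finite_closedBall x 1).biUnion fun y _ ↦
    (Set.finite_Iio (m x + m y)).image fun j ↦ (x, y, j)).subset ?_
  rintro _ ⟨⟨⟨a, b, j⟩, h1, h2⟩, rfl, rfl⟩
  refine Set.mem_biUnion (x := b) ?_ ⟨j, h2, rfl⟩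
  rw [Metric.mem_closedBall, dist_comm]
  exact h1

theorem finite_tgt (hbg : BddGeom X) (x : X) : {τ : UnitEdge m | τ.tgt = x}.Finite := by
  refine Set.Finite.of_finite_image (f := Subtype.val) ?_ Subtype.val_injective.injOn
  refine ((hbg.finite_closedBall x 1).biUnion fun y _ ↦
    (Set.finite_Iio (m y + m x)).image fun j ↦ (y, x, j)).subset ?_
  rintro _ ⟨⟨⟨a, b, j⟩, h1, h2⟩, rfl, rfl⟩
  exact Set.mem_biUnion (x := a) h1 ⟨j, h2, rfl⟩

theorem ncard_src_tgt_le (x y : X) :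
    {τ : UnitEdge m | τ.src = x ∧ τ.tgt = y}.ncard ≤ m x + m y := by
  rw [← Set.ncard_image_of_injective _ Subtype.val_injective]
  calc _ ≤ ((fun j ↦ (x, y, j)) '' Set.Iio (m x + m y)).ncard := by
        refine Set.ncard_le_ncard ?_ ((Set.finite_Iio _).image _)
        rintro _ ⟨⟨⟨a, b, j⟩, h1, h2⟩, ⟨rfl, rfl⟩, rfl⟩
        exact ⟨j, h2, rfl⟩
    _ ≤ (Set.Iio (m x + m y)).ncard := Set.ncard_image_le (Set.finite_Iio _)
    _ = _ := by simp [Set.ncard_eq_toFinset_card']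

open Finset in
/-- The weight of `isoBdry A` is at most the number of edges entering `A`. -/
theorem sum_isoBdry_le (hbg : BddGeom X) (A : Finset X) (E : Finset (UnitEdge m))
    (hE : ∀ τ : UnitEdge m, τ.src ∉ A → τ.tgt ∈ A → τ ∈ E) :
    ∑ z ∈ (hbg.finite_isoBdry A).toFinset, m z ≤ #E := by
  classical
  have hw : ∀ z : X, ∃ w, z ∈ isoBdry (A : Set X) → dist z w ≤ 1 ∧ (w ∈ A ↔ z ∉ A) := by
    intro z
    by_cases hz : z ∈ isoBdry (A : Set X)
    · obtain ⟨⟨a, ha, hza⟩, b, hb, hzb⟩ := hz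
      by_cases h : z ∈ A
      · exact ⟨b, fun _ ↦ ⟨hzb, by simpa [h] using hb⟩⟩
      · exact ⟨a, fun _ ↦ ⟨hza, by simpa [h] using ha⟩⟩
    · exact ⟨z, fun h ↦ absurd h hz⟩
  choose w hw using hw
  let S := (hbg.finite_isoBdry A).toFinset.sigma fun z ↦ range (m z)
  let φ : (_ : X) × ℕ → X × X × ℕ := fun p ↦
    if p.1 ∈ A then (w p.1, p.1, m (w p.1) + p.2) else (p.1, w p.1, p.2)
  have hS : ∀ p ∈ S, p.1 ∈ isoBdry (A : Set X) ∧ p.2 < m p.1 := by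
    intro p hp
    simpa [S] using hp
  calc ∑ z ∈ (hbg.finite_isoBdry A).toFinset, m z = #S := by simp [S, card_sigma]
    _ ≤ #(E.map (Function.Embedding.subtype _)) := by
      refine card_le_card_of_injOn φ ?_ ?_
      · intro p hp
        obtain ⟨hp1, hp2⟩ := hS p hp
        obtain ⟨h1, h2⟩ := hw _ hp1
        by_cases h : p.1 ∈ A
        · refine mem_map.2 ⟨⟨(w p.1, p.1, m (w p.1) + p.2), by rwa [dist_comm], ?_⟩, hE _ ?_ h, ?_⟩
          · simpa using hp2
          · simpa [src, h2] using h
          · simp [φ, h]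
        · refine mem_map.2 ⟨⟨(p.1, w p.1, p.2), h1, ?_⟩, hE _ h (h2.2 h), ?_⟩
          · simpa using hp2.trans_le (Nat.le_add_right _ _)
          · simp [φ, h]
      · rintro ⟨x, i⟩ hp ⟨y, j⟩ hq hpq
        obtain ⟨hp1, hp2⟩ := hS _ hp
        obtain ⟨hq1, hq2⟩ := hS _ hq
        by_cases hx : x ∈ A <;> by_cases hy : y ∈ A <;>
          simp only [φ, hx, hy, if_true, if_false, Prod.mk.injEq] at hpq
        · obtain ⟨-, rfl, h⟩ := hpq
          simpa using h
        · obtain ⟨rfl, -, h⟩ := hpq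
          simp only at hq2
          omega
        · obtain ⟨rfl, -, h⟩ := hpq
          simp only at hp2
          omega
        · obtain ⟨rfl, -, h⟩ := hpq
          simpa using h
    _ = #E := card_map _

end UnitEdge

open Finset in
theorem SatIso.exists_chain {X : Type*} [MetricSpace X] {e : X} {f : ℝ → ℝ}
    (hbg : BddGeom X) (hf : IsControlFun f) (hiso : SatIso e f) :
    ∃ ψ : X → X → ℝ, IsCtrlChain e f ψ ∧ ∀ x : X, ∑ᶠ y : X, ψ y x = 1 := by
  classical
  obtain ⟨C, hC, hiso⟩ := hiso
  let m : X → ℕ := fun x ↦ ⌈C * f (dist x e)⌉₊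
  let out : X → Finset (UnitEdge m) := fun x ↦ (UnitEdge.finite_src hbg x).toFinset
  let inn : X → Finset (UnitEdge m) := fun x ↦ (UnitEdge.finite_tgt hbg x).toFinset
  have hout : ∀ x τ, τ ∈ out x ↔ τ.src = x := by simp [out]
  have hinn : ∀ x τ, τ ∈ inn x ↔ τ.tgt = x := by simp [inn]
  obtain ⟨P, _, hP⟩ := exists_edges_indegree_eq_outdegree_add_one UnitEdge.src UnitEdge.tgt out inn
    hout hinn (by
      intro A
      refine le_trans ?_ (UnitEdge.sum_isoBdry_le hbg A _ fun τ h1 h2 ↦ ?_)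
      · have := hiso A
        rw [finsum_mem_eq_finite_toFinset_sum _ (hbg.finite_isoBdry A), mul_sum] at this
        have := this.trans (sum_le_sum fun z _ ↦ Nat.le_ceil (C * f (dist z e)))
        exact_mod_cast this
      · simp only [mem_sdiff, mem_biUnion, hinn, hout, exists_eq_right']
        exact ⟨h2, h1⟩)
  let F : X → X → ℕ := fun x y ↦ {τ : UnitEdge m | (τ.src = x ∧ τ.tgt = y) ∧ P τ}.ncard
  have hFle : ∀ x y, F x y ≤ m x + m y := fun x y ↦
    (Set.ncard_le_ncard (fun τ h ↦ h.1)
      ((UnitEdge.finite_src hbg x).subset fun τ h ↦ h.1)).trans (UnitEdge.ncard_src_tgt_le x y)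
  have hF0 : ∀ x y, 1 < dist x y → F x y = 0 := by
    intro x y hxy
    have : {τ : UnitEdge m | (τ.src = x ∧ τ.tgt = y) ∧ P τ} = ∅ := by
      refine Set.eq_empty_of_forall_notMem ?_
      rintro τ ⟨⟨rfl, rfl⟩, -⟩
      exact hxy.not_ge τ.2.1
    simp only [F, this, Set.ncard_empty]
  have hm : ∀ x, (m x : ℝ) ≤ (C + 1) * f (dist x e) := by
    intro x
    have h1 := hf.one_le (dist_nonneg (x := x) (y := e))
    have := Nat.ceil_lt_add_one (show 0 ≤ C * f (dist x e) by positivity)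
    simp only [m]
    linarith
  have hFf : ∀ x y, (F x y : ℝ) ≤ 2 * (C + 1) * f (max (dist x e) (dist y e)) := by
    intro x y
    have h1 := hf.mono _ _ dist_nonneg (le_max_left (dist x e) (dist y e))
    have h2 := hf.mono _ _ dist_nonneg (le_max_right (dist x e) (dist y e))
    calc (F x y : ℝ) ≤ m x + m y := by exact_mod_cast hFle x y
      _ ≤ (C + 1) * f (dist x e) + (C + 1) * f (dist y e) := add_le_add (hm x) (hm y)
      _ ≤ (C + 1) * f (max (dist x e) (dist y e)) + (C + 1) * f (max (dist x e) (dist y e)) := by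
        gcongr
      _ = _ := by ring
  refine ⟨fun x y ↦ F x y - F y x, ⟨fun x y ↦ by ring, ⟨1, one_pos, fun x y h ↦ ?_⟩,
    2 * (C + 1), by positivity, fun x y ↦ ?_⟩, fun x ↦ ?_⟩
  · simp [hF0 x y h, hF0 y x (by rwa [dist_comm])]
  · have h1 := hFf x y
    have h2 := hFf y x
    rw [max_comm] at h2
    exact abs_sub_le_of_nonneg_of_le (Nat.cast_nonneg _) h1 (Nat.cast_nonneg _) h2
  · let B := (hbg.finite_closedBall x 1).toFinset
    have hB : ∀ y, y ∈ B ↔ dist y x ≤ 1 := by simp [B]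
    have hin : #((inn x).filter P) = ∑ y ∈ B, F y x := by
      rw [card_eq_sum_card_fiberwise (f := UnitEdge.src) (t := B)]
      · refine sum_congr rfl fun y _ ↦ ?_
        rw [← Set.ncard_coe_finset]
        congr 1
        ext τ
        simp only [coe_filter, mem_filter, hinn, Set.mem_ofPred_eq]
        tauto
      · intro τ hτ
        simp only [coe_filter, Set.mem_ofPred_eq, hinn] at hτ
        rw [mem_coe, hB, ← hτ.1]
        exact τ.2.1
    have hou : #((out x).filter P) = ∑ y ∈ B, F x y := by
      rw [card_eq_sum_card_fiberwise (f := UnitEdge.tgt) (t := B)]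
      · refine sum_congr rfl fun y _ ↦ ?_
        rw [← Set.ncard_coe_finset]
        congr 1
        ext τ
        simp only [coe_filter, mem_filter, hout, Set.mem_ofPred_eq]
        tauto
      · intro τ hτ
        simp only [coe_filter, Set.mem_ofPred_eq, hout] at hτ
        rw [mem_coe, hB, ← hτ.1, dist_comm]
        exact τ.2.1
    have hPx := hP x
    rw [hin, hou] at hPx
    rw [finsum_eq_sum_of_support_subset (s := B), sum_sub_distrib, sub_eq_iff_eq_add']
    · exact_mod_cast hPx
    · intro y hy
      rw [mem_coe, hB]
      refine not_lt.1 fun h ↦ hy ?_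
      simp [hF0 y x h, hF0 x y (by rwa [dist_comm])]

/-- On a uniformly discrete, bounded geometry, quasi-geodesic
space, the isoperimetric inequality `(I^f_∂)` holds iff the fundamental class
vanishes in `H_0^f(X)`. -/
theorem satIso_iff_fundamental_class_vanishes
    {X : Type*} [MetricSpace X] (e : X) (f : ℝ → ℝ)
    (hud : UnifDiscrete X) (hbg : BddGeom X) (hqg : QuasiGeodesic X)
    (hf : IsControlFun f) :
    SatIso e f ↔
      ∃ ψ : X → X → ℝ, IsCtrlChain e f ψ ∧ ∀ x : X, ∑ᶠ y : X, ψ y x = 1 := by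
  exact ⟨fun h ↦ h.exists_chain hbg hf, fun ⟨_, hψ, hd⟩ ↦ satIso_of_chain hbg hqg hf hψ hd⟩
end

section
/- Let X be a uniformly discrete metric space of bounded geometry and f a control function. The following are equivalent: (a) X satisfies the isoperimetric inequality (I^f_∂); (b) there exists D > 0 such that for every finitely supported function η : X → ℝ, ∑_{x∈X} |η(x)| ≤ D·∑_{x∈X} ∑_{y∈X, d(x,y)≤1} |η(x) − η(y)|·f(|(x,y)|). -/
/-- Discrete co-area principle: an isoperimetric inequality for indicators of subsets of a
finite set `S` extends to all nonnegative functions supported in `S`. -/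
theorem sum_le_sum_abs_sub_of_indicator {X : Type*} (S T : Finset X) (B : X → Finset X)
    (w : X → X → ℝ) (C : ℝ)
    (h : ∀ A : Finset X, A ⊆ S → (A.card : ℝ) ≤ C * ∑ x ∈ T, ∑ y ∈ B x,
      |(A : Set X).indicator (1 : X → ℝ) x - (A : Set X).indicator (1 : X → ℝ) y| * w x y)
    (g : X → ℝ) (hg : ∀ x, 0 ≤ g x) (hS : ∀ x, g x ≠ 0 → x ∈ S) :
    ∑ x ∈ S, g x ≤ C * ∑ x ∈ T, ∑ y ∈ B x, |g x - g y| * w x y := by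
  classical
  induction hn : (S.filter (fun x => g x ≠ 0)).card using Nat.strong_induction_on
    generalizing g with
  | _ n ih =>
  set A := S.filter (fun x => g x ≠ 0) with hA
  have memA : ∀ x, x ∈ A ↔ g x ≠ 0 := fun x => by
    rw [hA, Finset.mem_filter]
    exact ⟨fun hx => hx.2, fun hx => ⟨hS x hx, hx⟩⟩
  rcases A.eq_empty_or_nonempty with h0 | hne
  · have hz : ∀ x, g x = 0 := fun x => by
      by_contra hx
      have := (memA x).2 hx
      simp [h0] at this
    simp [hz]
  obtain ⟨a, haA, hmin⟩ := A.exists_min_image g hne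
  have hind : ∀ x, (A : Set X).indicator (1 : X → ℝ) x = if g x ≠ 0 then 1 else 0 := fun x => by
    simp only [Set.indicator_apply, Finset.mem_coe, memA, Pi.one_apply]
  set g' : X → ℝ := fun x => g x - g a * (A : Set X).indicator (1 : X → ℝ) x with hg'
  have hle : ∀ x, g x ≠ 0 → g a ≤ g x := fun x hx => hmin x ((memA x).2 hx)
  have hg'0 : ∀ x, g x = 0 → g' x = 0 := fun x hx => by simp [hg', hind, hx]
  have hg'1 : ∀ x, g x ≠ 0 → g' x = g x - g a := fun x hx => by simp [hg', hind, hx]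
  have hpos : ∀ x, 0 ≤ g' x := fun x => by
    by_cases hx : g x = 0
    · rw [hg'0 x hx]
    · rw [hg'1 x hx]; linarith [hle x hx]
  have hsupp : ∀ x, g' x ≠ 0 → g x ≠ 0 := fun x hx h0 => hx (hg'0 x h0)
  have hlt : (S.filter (fun x => g' x ≠ 0)).card < n := by
    rw [← hn]
    apply Finset.card_lt_card
    rw [Finset.ssubset_iff_of_subset]
    · refine ⟨a, haA, ?_⟩
      simp [hg'1 a ((memA a).1 haA)]
    · intro x hx
      exact (memA x).2 (hsupp x (Finset.mem_filter.1 hx).2)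
  have hrec := ih _ hlt g' hpos (fun x hx => hS x (hsupp x hx)) rfl
  have habs : ∀ x y, |g x - g y| = |g' x - g' y| + g a *
      |(A : Set X).indicator (1 : X → ℝ) x - (A : Set X).indicator (1 : X → ℝ) y| := by
    intro x y
    have ha := hg a
    by_cases hx : g x = 0 <;> by_cases hy : g y = 0
    · simp [hx, hy, hg'0, hind]
    · have := hle y hy
      rw [hg'0 x hx, hg'1 y hy, hind, hind, if_neg (not_not.2 hx), if_pos hy, hx,
        abs_of_nonpos (by linarith), abs_of_nonpos (by linarith)]
      norm_num
    · have := hle x hx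
      rw [hg'1 x hx, hg'0 y hy, hind, hind, if_pos hx, if_neg (not_not.2 hy), hy,
        abs_of_nonneg (by linarith), abs_of_nonneg (by linarith)]
      norm_num
    · rw [hg'1 x hx, hg'1 y hy, hind, hind, if_pos hx, if_pos hy]
      simp
  have hsum : ∑ x ∈ S, g x = ∑ x ∈ S, g' x + g a * A.card := by
    have : ∑ x ∈ S, (A : Set X).indicator (1 : X → ℝ) x = A.card := by
      simp_rw [hind]
      rw [Finset.sum_ite]
      simp [hA]
    rw [← this, Finset.mul_sum, ← Finset.sum_add_distrib]
    simp [hg']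
  have hA' := mul_le_mul_of_nonneg_left (h A (Finset.filter_subset _ _)) (hg a)
  have hE : ∑ x ∈ T, ∑ y ∈ B x, |g x - g y| * w x y =
      ∑ x ∈ T, ∑ y ∈ B x, |g' x - g' y| * w x y + g a * ∑ x ∈ T, ∑ y ∈ B x,
        |(A : Set X).indicator (1 : X → ℝ) x - (A : Set X).indicator (1 : X → ℝ) y| * w x y := by
    simp_rw [Finset.mul_sum, ← Finset.sum_add_distrib]
    refine Finset.sum_congr rfl fun x _ => Finset.sum_congr rfl fun y _ => ?_
    rw [habs]; ring
  rw [hsum, hE]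
  linarith

/-- Near a point at distance `t`, a control function is bounded by a multiple of `f t`. -/
theorem IsControlFun.exists_shift_one {f : ℝ → ℝ} (hf : IsControlFun f) :
    ∃ L > (0 : ℝ), ∀ t, 0 ≤ t → f (t + 1) ≤ L * f t := by
  obtain ⟨L, hL, h⟩ := hf.shift 1 one_pos
  refine ⟨max L (f 1), lt_max_of_lt_left hL, fun t ht => ?_⟩
  rcases ht.eq_or_lt with rfl | ht'
  · simp [hf.one_at_zero]
  · exact (h t ht').trans (mul_le_mul_of_nonneg_right (le_max_left _ _) (hf.nonneg t ht))

/-- A double `finsum` over pairs at distance at most one of a weighted gradient, as a finite sum. -/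
theorem finsum_gradient_eq_sum {X : Type*} [MetricSpace X]
    (hfin : ∀ x : X, (Metric.closedBall x 1).Finite) (w : X → X → ℝ) (η : X → ℝ) (T : Finset X)
    (hT : ∀ x a, η a ≠ 0 → dist x a ≤ 1 → x ∈ T) :
    ∑ᶠ x : X, ∑ᶠ y ∈ Metric.closedBall x 1, |η x - η y| * w x y =
      ∑ x ∈ T, ∑ y ∈ (hfin x).toFinset, |η x - η y| * w x y := by
  simp_rw [fun x => finsum_mem_eq_finite_toFinset_sum (fun y => |η x - η y| * w x y) (hfin x)]
  apply finsum_eq_sum_of_support_subset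
  intro x hx
  by_contra hxT
  refine hx (Finset.sum_eq_zero fun y hy => ?_)
  rw [Set.Finite.mem_toFinset, Metric.mem_closedBall, dist_comm] at hy
  have h1 : η x = 0 := by
    by_contra h
    exact hxT (hT x x h (by simp))
  have h2 : η y = 0 := by
    by_contra h
    exact hxT (hT x y h hy)
  simp [h1, h2]

/-- The finite set of points within distance one of a finite set. -/
theorem exists_finset_unit_nhd {X : Type*} [MetricSpace X]
    (hfin : ∀ x : X, (Metric.closedBall x 1).Finite) (S : Finset X) :
    ∃ T : Finset X, ∀ x, ∀ a ∈ S, dist x a ≤ 1 → x ∈ T := by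
  classical
  refine ⟨S.biUnion fun a => (hfin a).toFinset, fun x a ha hx => ?_⟩
  exact Finset.mem_biUnion.2 ⟨a, ha, by simpa using hx⟩

/-- A sum over the boundary of a set, written over a finite set containing the boundary. -/
theorem finsum_isoBdry_eq_sum {X : Type*} [MetricSpace X] (u : X → ℝ) (A T : Finset X)
    (hT : ∀ x, ∀ a ∈ A, dist x a ≤ 1 → x ∈ T) :
    ∑ᶠ x ∈ isoBdry (A : Set X), u x = ∑ x ∈ T, (isoBdry (A : Set X)).indicator u x := by
  rw [finsum_mem_def]
  apply finsum_eq_sum_of_support_subset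
  intro x hx
  obtain ⟨⟨a, ha, hxa⟩, -⟩ := Set.mem_of_indicator_ne_zero hx
  exact hT x a ha hxa

/-- The boundary weight of a set at a point is at most the weighted gradient of its indicator. -/
theorem indicator_isoBdry_le_sum {X : Type*} [MetricSpace X]
    (hfin : ∀ x : X, (Metric.closedBall x 1).Finite) (e : X) {f : ℝ → ℝ} (hf : IsControlFun f)
    (A : Set X) (x : X) :
    (isoBdry A).indicator (fun x => f (dist x e)) x ≤
      ∑ y ∈ (hfin x).toFinset, |A.indicator (1 : X → ℝ) x - A.indicator (1 : X → ℝ) y| *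
        f (max (dist x e) (dist y e)) := by
  have hnn : ∀ y ∈ (hfin x).toFinset,
      0 ≤ |A.indicator (1 : X → ℝ) x - A.indicator (1 : X → ℝ) y| *
        f (max (dist x e) (dist y e)) :=
    fun y _ => mul_nonneg (abs_nonneg _) (hf.nonneg _ (le_max_of_le_left dist_nonneg))
  by_cases hx : x ∈ isoBdry A
  · rw [Set.indicator_of_mem hx]
    obtain ⟨⟨a, ha, hxa⟩, b, hb, hxb⟩ := hx
    obtain ⟨y, hy, hxy⟩ : ∃ y, dist x y ≤ 1 ∧
        |A.indicator (1 : X → ℝ) x - A.indicator (1 : X → ℝ) y| = 1 := by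
      by_cases hxA : x ∈ A
      · exact ⟨b, hxb, by simp [hxA, Set.indicator_of_notMem hb]⟩
      · exact ⟨a, hxa, by simp [hxA, ha]⟩
    refine le_trans ?_ (Finset.single_le_sum hnn (a := y) (by simpa [dist_comm] using hy))
    rw [hxy, one_mul]
    exact hf.mono _ _ dist_nonneg (le_max_left _ _)
  · rw [Set.indicator_of_notMem hx]
    exact Finset.sum_nonneg hnn

/-- The weighted gradient of an indicator at a point is controlled by the boundary weight. -/
theorem sum_le_indicator_isoBdry {X : Type*} [MetricSpace X]
    (hfin : ∀ x : X, (Metric.closedBall x 1).Finite) {N : ℕ}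
    (hN : ∀ x : X, (Metric.closedBall x 1).ncard ≤ N) (e : X) {f : ℝ → ℝ} (hf : IsControlFun f)
    {L : ℝ} (hL : ∀ t, 0 ≤ t → f (t + 1) ≤ L * f t) (A : Set X) (x : X) :
    ∑ y ∈ (hfin x).toFinset, |A.indicator (1 : X → ℝ) x - A.indicator (1 : X → ℝ) y| *
        f (max (dist x e) (dist y e)) ≤
      N * L * (isoBdry A).indicator (fun x => f (dist x e)) x := by
  have hmem : ∀ y ∈ (hfin x).toFinset, dist x y ≤ 1 := fun y hy => by
    simpa [dist_comm] using hy
  by_cases hx : x ∈ isoBdry A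
  · rw [Set.indicator_of_mem hx]
    have hpos : 0 ≤ L * f (dist x e) :=
      (hf.nonneg _ (by positivity)).trans (hL (dist x e) dist_nonneg)
    have hcard : (((hfin x).toFinset.card : ℕ) : ℝ) ≤ N := by
      rw [← Set.ncard_eq_toFinset_card _ (hfin x)]
      exact_mod_cast hN x
    calc _ ≤ ∑ y ∈ (hfin x).toFinset, L * f (dist x e) := by
          refine Finset.sum_le_sum fun y hy => ?_
          have hmax : max (dist x e) (dist y e) ≤ dist x e + 1 := by
            refine max_le (by linarith) ?_
            have := dist_triangle y x e
            rw [dist_comm y x] at this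
            linarith [hmem y hy]
          have h0 : 0 ≤ max (dist x e) (dist y e) := le_max_of_le_left dist_nonneg
          have hle1 : |A.indicator (1 : X → ℝ) x - A.indicator (1 : X → ℝ) y| ≤ 1 := by
            by_cases h1 : x ∈ A <;> by_cases h2 : y ∈ A <;> simp [h1, h2]
          exact (mul_le_of_le_one_left (hf.nonneg _ h0) hle1).trans
            ((hf.mono _ _ h0 hmax).trans (hL _ dist_nonneg))
      _ ≤ N * L * f (dist x e) := by
          rw [Finset.sum_const, nsmul_eq_mul, mul_assoc]
          exact mul_le_mul_of_nonneg_right hcard hpos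
  · rw [Set.indicator_of_notMem hx, mul_zero]
    refine (Finset.sum_eq_zero fun y hy => ?_).le
    have hxy := hmem y hy
    by_cases h1 : x ∈ A <;> by_cases h2 : y ∈ A
    · simp [h1, h2]
    · exact absurd ⟨⟨x, h1, by simp⟩, y, h2, hxy⟩ hx
    · exact absurd ⟨⟨y, h2, hxy⟩, x, h1, by simp⟩ hx
    · simp [h1, h2]

/-- The isoperimetric inequality `(I^f_∂)` is equivalent to its
functional form `(I^f_∇)` for finitely supported functions. -/
theorem satIso_iff_functional_inequality
    {X : Type*} [MetricSpace X] (e : X) (f : ℝ → ℝ)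
    (hud : UnifDiscrete X) (hbg : BddGeom X) (hf : IsControlFun f) :
    SatIso e f ↔
      ∃ D > (0:ℝ), ∀ η : X → ℝ, (Function.support η).Finite →
        ∑ᶠ x : X, |η x| ≤
          D * ∑ᶠ x : X, ∑ᶠ y ∈ Metric.closedBall x 1,
            |η x - η y| * f (max (dist x e) (dist y e)) := by
  obtain ⟨N, hbN⟩ := hbg 1 one_pos
  have hfin : ∀ x : X, (Metric.closedBall x 1).Finite := fun x => (hbN x).1
  have hN : ∀ x : X, (Metric.closedBall x 1).ncard ≤ N := fun x => (hbN x).2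
  constructor
  · rintro ⟨C, hC, h⟩
    refine ⟨C, hC, fun η hη => ?_⟩
    have hS : ∀ x, |η x| ≠ 0 → x ∈ hη.toFinset := fun x hx => by simpa using hx
    obtain ⟨T, hT⟩ := exists_finset_unit_nhd hfin hη.toFinset
    rw [finsum_gradient_eq_sum hfin (fun x y => f (max (dist x e) (dist y e))) η T
      (fun x a ha => hT x a (by simpa using ha)),
      finsum_eq_sum_of_support_subset (s := hη.toFinset) _ (fun x hx => hS x hx)]
    refine (sum_le_sum_abs_sub_of_indicator hη.toFinset T (fun x => (hfin x).toFinset)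
      (fun x y => f (max (dist x e) (dist y e))) C (fun A hA => ?_) (fun x => |η x|)
      (fun x => abs_nonneg _) hS).trans ?_
    · refine (h A).trans (mul_le_mul_of_nonneg_left ?_ hC.le)
      rw [finsum_isoBdry_eq_sum _ A T (fun x a ha => hT x a (hA ha))]
      exact Finset.sum_le_sum fun x _ => indicator_isoBdry_le_sum hfin e hf A x
    · refine mul_le_mul_of_nonneg_left (Finset.sum_le_sum fun x _ => Finset.sum_le_sum
        fun y _ => ?_) hC.le
      exact mul_le_mul_of_nonneg_right (abs_abs_sub_abs_le_abs_sub _ _)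
        (hf.nonneg _ (le_max_of_le_left dist_nonneg))
  · rintro ⟨D, hD, h⟩
    obtain ⟨L, hL0, hL⟩ := hf.exists_shift_one
    have hNpos : 0 < N := lt_of_lt_of_le
      ((Set.ncard_pos (hfin e)).2 ⟨e, by simp⟩) (hN e)
    refine ⟨D * (N * L), by positivity, fun A => ?_⟩
    obtain ⟨T, hT⟩ := exists_finset_unit_nhd hfin A
    have hsub : Function.support ((A : Set X).indicator (1 : X → ℝ)) ⊆ A :=
      Set.support_indicator_subset
    have key := h ((A : Set X).indicator 1) (A.finite_toSet.subset hsub)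
    rw [finsum_gradient_eq_sum hfin (fun x y => f (max (dist x e) (dist y e))) _ T
      (fun x a ha => hT x a (hsub ha)), finsum_eq_sum_of_support_subset (s := A) _
        (fun x hx => hsub (abs_ne_zero.1 hx))] at key
    have hcard : ∑ x ∈ A, |(A : Set X).indicator (1 : X → ℝ) x| = A.card := by
      rw [Finset.sum_congr rfl (g := fun _ => (1 : ℝ)) (fun x hx => by simp [hx])]
      simp
    rw [hcard] at key
    refine key.trans ?_
    rw [mul_assoc, finsum_isoBdry_eq_sum _ A T hT, Finset.mul_sum (a := (N : ℝ) * L)]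
    exact mul_le_mul_of_nonneg_left
      (Finset.sum_le_sum fun x _ => sum_le_indicator_isoBdry hfin hN e hf hL A x) hD.le
end

section
/- Let X be a uniformly discrete metric space of bounded geometry and f a control function. Suppose c : X → ℝ satisfies C ≤ c(x) ≤ K·f(|x|) for all x ∈ X, for some constants C, K > 0, and suppose c = ∂φ for some f-controlled 1-chain φ on X. Then the fundamental class [X] vanishes in H_0^f(X): there exists an f-controlled 1-chain ψ with ∂ψ(x) = 1 for all x ∈ X. -/
/-- If a nonnegative locally finite flow `w` has inflow exceeding outflow by at least `C > 0` at
every vertex, then rescaling the inflow at each vertex by a suitable factor in `[0, 1]` makes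
the net inflow exactly `C` everywhere. -/
lemma exists_inflow_rescaling {X : Type*} (s : X → Finset X) (w : X → X → ℝ)
    (hw : ∀ x y, 0 ≤ w x y) {C : ℝ} (hC : 0 < C)
    (h : ∀ x, C + ∑ y ∈ s x, w x y ≤ ∑ y ∈ s x, w y x) :
    ∃ a : X → ℝ, (∀ x, 0 ≤ a x) ∧ (∀ x, a x ≤ 1) ∧
      ∀ x, a x * ∑ y ∈ s x, w y x = C + ∑ y ∈ s x, w x y * a y := by
  have hout : ∀ x, 0 ≤ ∑ y ∈ s x, w x y := fun x => Finset.sum_nonneg fun y _ => hw x y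
  have hin : ∀ x, 0 < ∑ y ∈ s x, w y x := fun x => by linarith [h x, hout x]
  let F : (X → Set.Icc (0:ℝ) 1) →o (X → Set.Icc (0:ℝ) 1) :=
    { toFun := fun a x => ⟨(C + ∑ y ∈ s x, w x y * (a y : ℝ)) / ∑ y ∈ s x, w y x, by
        have h₁ : 0 ≤ ∑ y ∈ s x, w x y * (a y : ℝ) :=
          Finset.sum_nonneg fun y _ => mul_nonneg (hw x y) (a y).2.1
        have h₂ : ∑ y ∈ s x, w x y * (a y : ℝ) ≤ ∑ y ∈ s x, w x y :=
          Finset.sum_le_sum fun y _ => mul_le_of_le_one_right (hw x y) (a y).2.2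
        exact ⟨div_nonneg (by linarith) (hin x).le,
          (div_le_one (hin x)).2 (by linarith [h x])⟩⟩
      monotone' := fun a b hab x => by
        refine Subtype.mk_le_mk.2 (div_le_div_of_nonneg_right (add_le_add le_rfl ?_) (hin x).le)
        exact Finset.sum_le_sum fun y _ => mul_le_mul_of_nonneg_left (hab y) (hw x y) }
  refine ⟨fun x => OrderHom.lfp F x, fun x => (OrderHom.lfp F x).2.1, 
    fun x => (OrderHom.lfp F x).2.2, fun x => ?_⟩
  have hfix : ((F (OrderHom.lfp F) x : Set.Icc (0:ℝ) 1) : ℝ) = OrderHom.lfp F x := by rw [F.map_lfp]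
  exact (eq_div_iff (hin x).ne').1 hfix.symm

/-- If a 0-chain bounded below by a positive constant and above by
a multiple of `f(|x|)` is the boundary of an `f`-controlled 1-chain, then the
fundamental class vanishes in `H_0^f(X)`. -/
theorem fundamental_class_vanishes_of_bounded_below_boundary
    {X : Type*} [MetricSpace X] (e : X) (f : ℝ → ℝ)
    (hud : UnifDiscrete X) (hbg : BddGeom X) (hf : IsControlFun f)
    (c : X → ℝ) (C K : ℝ) (hC : 0 < C) (hK : 0 < K)
    (hlb : ∀ x, C ≤ c x) (hub : ∀ x, c x ≤ K * f (dist x e))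
    (φ : X → X → ℝ) (hφ : IsCtrlChain e f φ)
    (hbd : ∀ x : X, ∑ᶠ y : X, φ y x = c x) :
    ∃ ψ : X → X → ℝ, IsCtrlChain e f ψ ∧ ∀ x : X, ∑ᶠ y : X, ψ y x = 1 := by
  obtain ⟨R, hR, hφR⟩ := hφ.finprop
  obtain ⟨B, hB, hφB⟩ := hφ.bound
  obtain ⟨N, hN⟩ := hbg R hR
  let s : X → Finset X := fun x => (hN x).1.toFinset
  have hs : ∀ {x y : X}, y ∉ s x → φ x y = 0 ∧ φ y x = 0 := fun {x y} hy => by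
    have hd : R < dist y x := by simpa [s] using hy
    exact ⟨hφR x y (by rwa [dist_comm]), hφR y x hd⟩
  have hsum : ∀ (g : X → ℝ) (x : X), (∀ y, y ∉ s x → g y = 0) →
      ∑ᶠ y, g y = ∑ y ∈ s x, g y := fun g x hg =>
    finsum_eq_sum_of_support_subset _ fun y hy => by
      by_contra hy'
      exact hy (hg y hy')
  let w : X → X → ℝ := fun x y => max (φ x y) 0
  have hw : ∀ x y, 0 ≤ w x y := fun x y => le_max_right _ _
  have hsub : ∀ x y, w x y - w y x = φ x y := fun x y => by
    simp only [w, hφ.antisymm y x]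
    exact max_zero_sub_max_neg_zero_eq_self _
  have hadd : ∀ x y, w x y + w y x = |φ x y| := fun x y => by
    simp only [w, hφ.antisymm y x]
    exact max_zero_add_max_neg_zero_eq_abs_self _
  obtain ⟨a, ha₀, ha₁, ha⟩ := exists_inflow_rescaling s w hw hC fun x => by
    have hx := hbd x
    rw [hsum _ x fun y hy => (hs hy).2] at hx
    simp only [← hsub, Finset.sum_sub_distrib] at hx
    linarith [hlb x]
  have hle : ∀ x y, |w x y * a y - w y x * a x| ≤ |φ x y| := fun x y => by
    have h₁ := mul_nonneg (hw x y) (ha₀ y)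
    have h₂ := mul_nonneg (hw y x) (ha₀ x)
    have h₃ := mul_le_of_le_one_right (hw x y) (ha₁ y)
    have h₄ := mul_le_of_le_one_right (hw y x) (ha₁ x)
    rw [← hadd, abs_le]
    constructor <;> linarith
  have hzero : ∀ x y, φ x y = 0 → w x y * a y - w y x * a x = 0 := fun x y h =>
    abs_nonpos_iff.1 ((hle x y).trans (by simp [h]))
  refine ⟨fun x y => (w x y * a y - w y x * a x) / C,
    ⟨fun x y => by ring, ⟨R, hR, fun x y hxy => ?_⟩, ⟨B / C, by positivity, fun x y => ?_⟩⟩,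
    fun x => ?_⟩
  · rw [hzero x y (hφR x y hxy), zero_div]
  · rw [abs_div, abs_of_pos hC, div_mul_eq_mul_div]
    exact div_le_div_of_nonneg_right ((hle x y).trans (hφB x y)) hC.le
  · rw [hsum _ x fun y hy => by simp only [hzero y x (hs hy).2, zero_div], ← Finset.sum_div,
      Finset.sum_sub_distrib, ← Finset.sum_mul, mul_comm, ha, add_sub_cancel_right,
      div_self hC.ne']
end

section
/- Let X be a uniformly discrete, bounded geometry, quasi-geodesic metric space and f a control function. The following are equivalent: (1) the fundamental class [X] vanishes in H_0^f(X), i.e. there exists an f-controlled 1-chain ψ with ∂ψ(x) = 1 for all x; (2) the natural map H_0^{uf}(X) → H_0^f(X) is trivial, i.e. for every bounded function c : X → ℝ there exists an f-controlled 1-chain ψ with ∂ψ(x) = c(x) for all x ∈ X. -/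
/-- Antisymmetric functions on `X × X` dominated in absolute value by `φ`. -/
def dominatedChains {X : Type*} (φ : X → X → ℝ) : Set (X → X → ℝ) :=
  {ψ | (∀ x y, ψ x y = - ψ y x) ∧ ∀ x y, |ψ x y| ≤ |φ x y|}

lemma isCompact_dominatedChains {X : Type*} (φ : X → X → ℝ) :
    IsCompact (dominatedChains φ) := by
  have hbox : IsCompact (Set.pi Set.univ fun x => Set.pi Set.univ fun y =>
      Set.Icc (-|φ x y|) |φ x y|) :=
    isCompact_univ_pi fun x => isCompact_univ_pi fun y => isCompact_Icc
  refine hbox.of_isClosed_subset ?_ ?_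
  · have h : dominatedChains φ =
        (⋂ x, ⋂ y, {ψ | ψ x y = - ψ y x}) ∩ ⋂ x, ⋂ y, {ψ | |ψ x y| ≤ |φ x y|} := by
      ext ψ
      simp [dominatedChains]
    rw [h]
    refine IsClosed.inter ?_ ?_
    · exact isClosed_iInter fun x => isClosed_iInter fun y =>
        isClosed_eq (by fun_prop) (by fun_prop)
    · exact isClosed_iInter fun x => isClosed_iInter fun y =>
        isClosed_le (by fun_prop) (by fun_prop)
  · intro ψ hψ x _ y _
    exact abs_le.1 (hψ.2 x y)

lemma convex_dominatedChains {X : Type*} (φ : X → X → ℝ) :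
    Convex ℝ (dominatedChains φ) := by
  intro ψ hψ χ hχ a b ha hb hab
  refine ⟨fun x y => ?_, fun x y => ?_⟩
  · simp only [Pi.add_apply, Pi.smul_apply, smul_eq_mul]
    rw [hψ.1 x y, hχ.1 x y]
    ring
  · simp only [Pi.add_apply, Pi.smul_apply, smul_eq_mul]
    calc |a * ψ x y + b * χ x y| ≤ |a * ψ x y| + |b * χ x y| := abs_add_le _ _
      _ = a * |ψ x y| + b * |χ x y| := by
        rw [abs_mul, abs_mul, abs_of_nonneg ha, abs_of_nonneg hb]
      _ ≤ a * |φ x y| + b * |φ x y| := by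
        exact add_le_add (mul_le_mul_of_nonneg_left (hψ.2 x y) ha)
          (mul_le_mul_of_nonneg_left (hχ.2 x y) hb)
      _ = |φ x y| := by rw [← add_mul, hab, one_mul]

/-- The boundary of a 1-chain, as a linear map, where the sum at `x` runs over `N x`. -/
def boundaryOn {X : Type*} (N : X → Finset X) : (X → X → ℝ) →ₗ[ℝ] (X → ℝ) where
  toFun ψ x := ∑ y ∈ N x, ψ y x
  map_add' ψ χ := by
    ext x
    simp [Finset.sum_add_distrib]
  map_smul' a ψ := by
    ext x
    simp [Finset.mul_sum]

/-- Summation by parts against a function supported in a finite set `F`. -/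
lemma sum_mul_boundaryOn {X : Type*} {N : X → Finset X} {ψ : X → X → ℝ}
    (hψ : ∀ x y, ψ x y = - ψ y x) (hN : ∀ x y, y ∉ N x → ψ y x = 0)
    {F G : Finset X} (hFG : F ⊆ G) (hNG : ∀ x ∈ F, N x ⊆ G)
    {v : X → ℝ} (hv : ∀ x ∉ F, v x = 0) :
    2 * ∑ x ∈ F, v x * boundaryOn N ψ x =
      ∑ x ∈ G, ∑ y ∈ G, (v x - v y) * ψ y x := by
  have h1 : ∑ x ∈ F, v x * boundaryOn N ψ x = ∑ x ∈ G, ∑ y ∈ G, v x * ψ y x := by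
    calc ∑ x ∈ F, v x * boundaryOn N ψ x = ∑ x ∈ F, ∑ y ∈ G, v x * ψ y x := by
          refine Finset.sum_congr rfl fun x hx => ?_
          rw [← Finset.mul_sum]
          congr 1
          exact Finset.sum_subset (hNG x hx) fun y _ hy => hN x y hy
      _ = ∑ x ∈ G, ∑ y ∈ G, v x * ψ y x := by
          refine Finset.sum_subset hFG fun x _ hx => ?_
          simp [hv x hx]
  have h2 : ∑ x ∈ G, ∑ y ∈ G, v y * ψ y x = - ∑ x ∈ G, ∑ y ∈ G, v x * ψ y x := by
    rw [Finset.sum_comm, ← Finset.sum_neg_distrib]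
    refine Finset.sum_congr rfl fun x _ => ?_
    rw [← Finset.sum_neg_distrib]
    refine Finset.sum_congr rfl fun y _ => ?_
    rw [hψ x y]
    ring
  simp only [sub_mul, Finset.sum_sub_distrib]
  rw [h1, h2]
  ring

/-- If `φ` has boundary `1`, then for every `v` supported in a finite set, the `ℓ¹`-norm of `v`
is at most the value of `v` on the boundary of some chain dominated by `φ`. -/
lemma exists_dominated_sum_abs_le {X : Type*} {N : X → Finset X} {φ : X → X → ℝ}
    (hφ : ∀ x y, φ x y = - φ y x) (hN : ∀ x y, y ∉ N x → φ y x = 0)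
    (h1 : ∀ x, boundaryOn N φ x = 1) {F : Finset X} {v : X → ℝ} (hv : ∀ x ∉ F, v x = 0) :
    ∃ ψ ∈ dominatedChains φ, ∑ x ∈ F, |v x| ≤ ∑ x ∈ F, v x * boundaryOn N ψ x := by
  classical
  let ψ : X → X → ℝ := fun y x => |φ y x| * (SignType.sign (v x - v y) : ℝ)
  have hψ : ψ ∈ dominatedChains φ := by
    refine ⟨fun x y => ?_, fun x y => ?_⟩
    · change |φ x y| * (SignType.sign (v y - v x) : ℝ) =
        -(|φ y x| * (SignType.sign (v x - v y) : ℝ))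
      rw [hφ x y, abs_neg, ← neg_sub (v x) (v y), Left.sign_neg]
      simp
    · change |(|φ x y| * (SignType.sign (v y - v x) : ℝ))| ≤ |φ x y|
      rw [abs_mul, abs_abs]
      refine mul_le_of_le_one_right (abs_nonneg _) ?_
      cases SignType.sign (v y - v x) <;> simp
  refine ⟨ψ, hψ, ?_⟩
  let G := F ∪ F.biUnion N
  have hFG : F ⊆ G := Finset.subset_union_left
  have hNG : ∀ x ∈ F, N x ⊆ G := fun x hx =>
    (Finset.subset_biUnion_of_mem N hx).trans Finset.subset_union_right
  have e1 := sum_mul_boundaryOn hφ hN hFG hNG (v := fun x => |v x|) (by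
    intro x hx
    simp [hv x hx])
  have e2 := sum_mul_boundaryOn hψ.1 (fun x y hy => by simp [ψ, hN x y hy]) hFG hNG hv
  simp only [h1, mul_one] at e1
  have hle : ∑ x ∈ G, ∑ y ∈ G, (|v x| - |v y|) * φ y x ≤
      ∑ x ∈ G, ∑ y ∈ G, (v x - v y) * ψ y x := by
    refine Finset.sum_le_sum fun x _ => Finset.sum_le_sum fun y _ => ?_
    calc (|v x| - |v y|) * φ y x ≤ |(|v x| - |v y|) * φ y x| := le_abs_self _
      _ = |(|v x| - |v y|)| * |φ y x| := abs_mul _ _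
      _ ≤ |v x - v y| * |φ y x| := by
        exact mul_le_mul_of_nonneg_right (abs_abs_sub_abs_le (v x) (v y)) (abs_nonneg _)
      _ = (v x - v y) * ψ y x := by
        rw [← self_mul_sign (v x - v y)]
        simp only [ψ]
        ring
  linarith

/-- If `φ` has boundary `1`, every `c` with `|c| ≤ 1` agrees on any given finite set with the
boundary of some chain dominated by `φ`. -/
lemma exists_dominated_boundary_eq_on_finset {X : Type*} {N : X → Finset X} {φ : X → X → ℝ}
    (hφ : ∀ x y, φ x y = - φ y x) (hN : ∀ x y, y ∉ N x → φ y x = 0)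
    (h1 : ∀ x, boundaryOn N φ x = 1) {c : X → ℝ} (hc : ∀ x, |c x| ≤ 1) (F : Finset X) :
    ∃ ψ ∈ dominatedChains φ, ∀ x ∈ F, boundaryOn N ψ x = c x := by
  classical
  let D : (X → X → ℝ) →ₗ[ℝ] (F → ℝ) :=
    (LinearMap.funLeft ℝ ℝ ((↑) : F → X)).comp (boundaryOn N)
  have hD : ∀ ψ x, D ψ x = boundaryOn N ψ x := fun _ _ => rfl
  have hDc : Continuous D := by
    refine continuous_pi fun x => ?_
    change Continuous fun ψ : X → X → ℝ => ∑ y ∈ N x, ψ y x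
    fun_prop
  by_contra! hne
  have hnot : (fun x : F => c x) ∉ D '' dominatedChains φ := by
    rintro ⟨ψ, hψ, hψc⟩
    obtain ⟨x, hx, hxc⟩ := hne ψ hψ
    exact hxc (congrFun hψc ⟨x, hx⟩)
  obtain ⟨g, s, hg, hgs⟩ := geometric_hahn_banach_closed_point
    ((convex_dominatedChains φ).linear_image D)
    ((isCompact_dominatedChains φ).image hDc).isClosed hnot
  let v : X → ℝ := fun x => if hx : x ∈ F then g (Pi.single ⟨x, hx⟩ 1) else 0
  have hgv : ∀ a : X → ℝ, g (fun x : F => a x) = ∑ x ∈ F, v x * a x := by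
    intro a
    have := LinearMap.pi_apply_eq_sum_univ (g : (F → ℝ) →ₗ[ℝ] ℝ) (fun x : F => a x)
    rw [← Finset.sum_coe_sort F]
    refine this.trans (Finset.sum_congr rfl fun x _ => ?_)
    simp only [v, x.2, dif_pos, smul_eq_mul, ContinuousLinearMap.coe_coe, mul_comm (a x)]
    congr 2
    ext y
    simp [Pi.single_apply, eq_comm]
  obtain ⟨ψ, hψ, hle⟩ := exists_dominated_sum_abs_le hφ hN h1 (F := F) (v := v)
    (fun x hx => by simp [v, hx])
  have hlt := hg _ (Set.mem_image_of_mem D hψ)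
  have hψg : g (D ψ) = _ := hgv (boundaryOn N ψ)
  rw [hψg] at hlt
  rw [hgv c] at hgs
  have hcv : ∑ x ∈ F, v x * c x ≤ ∑ x ∈ F, |v x| := by
    refine Finset.sum_le_sum fun x _ => (le_abs_self _).trans ?_
    rw [abs_mul]
    exact mul_le_of_le_one_right (abs_nonneg _) (hc x)
  linarith

/-- If `φ` has boundary `1`, every `c` with `|c| ≤ 1` is the boundary of some chain dominated
by `φ`. -/
lemma exists_dominated_boundary_eq {X : Type*} {N : X → Finset X} {φ : X → X → ℝ}
    (hφ : ∀ x y, φ x y = - φ y x) (hN : ∀ x y, y ∉ N x → φ y x = 0)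
    (h1 : ∀ x, boundaryOn N φ x = 1) {c : X → ℝ} (hc : ∀ x, |c x| ≤ 1) :
    ∃ ψ ∈ dominatedChains φ, ∀ x, boundaryOn N ψ x = c x := by
  obtain ⟨ψ, hψ, hψc⟩ := (isCompact_dominatedChains φ).inter_iInter_nonempty
    (fun x => {ψ | boundaryOn N ψ x = c x})
    (fun x => by
      change IsClosed {ψ : X → X → ℝ | ∑ y ∈ N x, ψ y x = c x}
      exact isClosed_eq (by fun_prop) continuous_const)
    (fun F => by
      obtain ⟨ψ, hψ, h⟩ := exists_dominated_boundary_eq_on_finset hφ hN h1 hc F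
      exact ⟨ψ, hψ, Set.mem_iInter₂.2 h⟩)
  exact ⟨ψ, hψ, Set.mem_iInter.1 hψc⟩

/-- The fundamental class vanishes in `H_0^f(X)` iff the natural
map `H_0^{uf}(X) → H_0^f(X)` is trivial, i.e. every bounded 0-chain bounds an
`f`-controlled 1-chain. -/
theorem fundamental_class_vanishes_iff_uf_map_trivial
    {X : Type*} [MetricSpace X] (e : X) (f : ℝ → ℝ)
    (hud : UnifDiscrete X) (hbg : BddGeom X) (hqg : QuasiGeodesic X)
    (hf : IsControlFun f) :
    (∃ ψ : X → X → ℝ, IsCtrlChain e f ψ ∧ ∀ x : X, ∑ᶠ y : X, ψ y x = 1) ↔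
      (∀ c : X → ℝ, (∃ M : ℝ, ∀ x, |c x| ≤ M) →
        ∃ ψ : X → X → ℝ, IsCtrlChain e f ψ ∧ ∀ x : X, ∑ᶠ y : X, ψ y x = c x) := by
  refine ⟨?_, fun h => h (fun _ => 1) ⟨1, by simp⟩⟩
  rintro ⟨φ, hφ, h1⟩ c ⟨M, hM⟩
  obtain ⟨R, hR, hprop⟩ := hφ.finprop
  obtain ⟨K, hK, hbd⟩ := hφ.bound
  obtain ⟨_, hfin⟩ := hbg R hR
  let N : X → Finset X := fun x => (hfin x).1.toFinset
  have hNR : ∀ x y, y ∉ N x → R < dist y x := fun x y hy => by simpa [N] using hy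
  have hsum : ∀ ψ : X → X → ℝ, (∀ x y, R < dist x y → ψ x y = 0) →
      ∀ x, ∑ᶠ y, ψ y x = boundaryOn N ψ x := fun ψ hψ x =>
    finsum_eq_sum_of_support_subset _ fun y hy => by
      by_contra hyN
      exact hy (hψ y x (hNR x y hyN))
  have hA : 0 < |M| + 1 := by positivity
  obtain ⟨ψ, hψ, hψc⟩ := exists_dominated_boundary_eq hφ.antisymm
    (fun x y hy => hprop y x (hNR x y hy)) (fun x => (hsum φ hprop x).symm.trans (h1 x))
    (c := fun x => c x / (|M| + 1)) (fun x => by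
      rw [abs_div, abs_of_pos hA, div_le_one hA]
      linarith [hM x, le_abs_self M])
  have hψ0 : ∀ x y, R < dist x y → ψ x y = 0 := fun x y hxy => by
    simpa [hprop x y hxy] using hψ.2 x y
  refine ⟨(|M| + 1) • ψ, ⟨fun x y => ?_, ⟨R, hR, fun x y hxy => ?_⟩,
    ⟨(|M| + 1) * K, mul_pos hA hK, fun x y => ?_⟩⟩, fun x => ?_⟩
  · simp [hψ.1 x y]
  · simp [hψ0 x y hxy]
  · rw [Pi.smul_apply, Pi.smul_apply, smul_eq_mul, abs_mul, abs_of_pos hA, mul_assoc]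
    exact mul_le_mul_of_nonneg_left ((hψ.2 x y).trans (hbd x y)) hA.le
  · rw [hsum _ (fun x y hxy => by simp [hψ0 x y hxy]), map_smul, Pi.smul_apply, hψc, smul_eq_mul]
    field_simp
end

section
/- Let X and Y be uniformly discrete metric spaces of bounded geometry, f a control function, and let F, F' : X → Y be quasi-isometric embeddings that are close. Then the pushforward chain maps F_*, F'_* : C_n^f(X) → C_n^f(Y) are chain homotopic: there exist linear maps H_n : C_n^f(X) → C_{n+1}^f(Y) for all n ≥ 0 such that ∂ ∘ H_n + H_{n−1} ∘ ∂ = F'_* − F_* on C_n^f(X) for every n (with H_{−1} = 0). In particular F and F' induce the same maps H_n^f(X) → H_n^f(Y) on homology. -/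
/-- An `f`-controlled `n`-chain on `X`: an alternating function on `(n+1)`-tuples,
of finite propagation, with coefficients controlled by `f`. -/
def IsNChain {X : Type*} [MetricSpace X] (e : X) (f : ℝ → ℝ) (n : ℕ)
    (ψ : (Fin (n + 1) → X) → ℝ) : Prop :=
  (∀ σ : Equiv.Perm (Fin (n + 1)), ∀ x : Fin (n + 1) → X,
      ψ (x ∘ σ) = ((Equiv.Perm.sign σ : ℤ) : ℝ) * ψ x) ∧
  (∃ R > (0:ℝ), ∀ x : Fin (n + 1) → X, (∃ i j, R < dist (x i) (x j)) → ψ x = 0) ∧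
  (∃ K > (0:ℝ), ∀ x : Fin (n + 1) → X, |ψ x| ≤ K * f (⨆ i, dist (x i) e))

/-- The boundary operator on chains: `(∂ψ)(x₀,…,xₙ) = ∑_y ψ(y, x₀, …, xₙ)`. -/
noncomputable def bdN {X : Type*} (n : ℕ) (ψ : (Fin (n + 2) → X) → ℝ) :
    (Fin (n + 1) → X) → ℝ :=
  fun x => ∑ᶠ y : X, ψ (Fin.cons y x)

/-- The pushforward of a chain along a map `F : X → Y`:
`(F_*ψ)(ȳ) = ∑_{x̄ : F∘x̄ = ȳ} ψ(x̄)`. -/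
noncomputable def pushf {X Y : Type*} (F : X → Y) (n : ℕ)
    (ψ : (Fin (n + 1) → X) → ℝ) : (Fin (n + 1) → Y) → ℝ :=
  fun y => ∑ᶠ (x : Fin (n + 1) → X) (_ : F ∘ x = y), ψ x

/-- A quasi-isometric embedding. -/
def QIEmb {X Y : Type*} [MetricSpace X] [MetricSpace Y] (F : X → Y) : Prop :=
  ∃ A ≥ (1:ℝ), ∃ B ≥ (0:ℝ), ∀ x y : X,
    A⁻¹ * dist x y - B ≤ dist (F x) (F y) ∧ dist (F x) (F y) ≤ A * dist x y + B

/-- The sum of `ψ` over the fibres of `g`. -/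
noncomputable def fiberSum {A B : Type*} (g : A → B) (ψ : A → ℝ) : B → ℝ :=
  fun b => ∑ᶠ (x : A) (_ : g x = b), ψ x

/-- The support of `ψ` meets every fibre of `g` in a finite set. -/
def FiniteFibers {A B : Type*} (g : A → B) (ψ : A → ℝ) : Prop :=
  ∀ b, {x | g x = b ∧ ψ x ≠ 0}.Finite

section FiberSum

variable {A B C : Type*}

theorem fiberSum_eq_sum [DecidableEq B] (g : A → B) (ψ : A → ℝ) (b : B) (T : Finset A)
    (hT : ∀ x, g x = b → ψ x ≠ 0 → x ∈ T) :
    fiberSum g ψ b = ∑ x ∈ T with g x = b, ψ x := by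
  unfold fiberSum
  refine finsum_mem_eq_sum_of_inter_support_eq (s := {x | g x = b}) ψ ?_
  ext x
  simp only [Set.mem_inter_iff, Set.mem_ofPred_eq, Function.mem_support, Finset.coe_filter]
  exact ⟨fun h => ⟨⟨hT x h.1 h.2, h.1⟩, h.2⟩, fun h => ⟨h.1.2, h.2⟩⟩

theorem exists_of_fiberSum_ne_zero {g : A → B} {ψ : A → ℝ} {b : B} (h : fiberSum g ψ b ≠ 0) :
    ∃ x, g x = b ∧ ψ x ≠ 0 := by
  by_contra! hn
  exact h (finsum_mem_eq_zero_of_forall_eq_zero (s := {x | g x = b}) hn)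

theorem fiberSum_comp (h : B → C) (g : A → B) (ψ : A → ℝ) (hf : FiniteFibers (h ∘ g) ψ) :
    fiberSum h (fiberSum g ψ) = fiberSum (h ∘ g) ψ := by
  classical
  funext c
  set T := (hf c).toFinset with hT
  have hmem : ∀ x, x ∈ T ↔ h (g x) = c ∧ ψ x ≠ 0 := fun x => by simp [hT]
  rw [fiberSum_eq_sum (h ∘ g) ψ c T fun x h1 h2 => (hmem x).2 ⟨h1, h2⟩,
    fiberSum_eq_sum h _ c (T.image g)]
  · have hb : ∀ b ∈ (T.image g).filter (fun b => h b = c),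
        fiberSum g ψ b = ∑ x ∈ T with g x = b, ψ x := by
      intro b hb
      refine fiberSum_eq_sum g ψ b T fun x h1 h2 => (hmem x).2 ⟨?_, h2⟩
      rw [h1]
      exact (Finset.mem_filter.1 hb).2
    rw [Finset.sum_congr rfl hb,
      Finset.filter_true_of_mem (s := T) (p := fun x => (h ∘ g) x = c) fun x hx =>
        ((hmem x).1 hx).1]
    refine Finset.sum_fiberwise_of_maps_to (fun x hx => ?_) ψ
    exact Finset.mem_filter.2 ⟨Finset.mem_image_of_mem g hx, ((hmem x).1 hx).1⟩
  · intro b h1 h2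
    obtain ⟨x, hx, hx'⟩ := exists_of_fiberSum_ne_zero h2
    exact Finset.mem_image.2 ⟨x, (hmem x).2 ⟨by rw [hx, h1], hx'⟩, hx⟩

theorem FiniteFibers.fiberSum {h : B → C} {g : A → B} {ψ : A → ℝ}
    (hf : FiniteFibers (h ∘ g) ψ) : FiniteFibers h (fiberSum g ψ) := by
  intro c
  refine ((hf c).image g).subset ?_
  rintro b ⟨h1, h2⟩
  obtain ⟨x, hx, hx'⟩ := exists_of_fiberSum_ne_zero h2
  exact ⟨x, ⟨by simp [hx, h1], hx'⟩, hx⟩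

theorem fiberSum_add (g : A → B) {ψ φ : A → ℝ} (hψ : FiniteFibers g ψ)
    (hφ : FiniteFibers g φ) : fiberSum g (ψ + φ) = fiberSum g ψ + fiberSum g φ := by
  funext b
  exact finsum_mem_add_distrib' (s := {x | g x = b}) (hψ b) (hφ b)

theorem fiberSum_smul (g : A → B) (a : ℝ) (ψ : A → ℝ) :
    fiberSum g (a • ψ) = a • fiberSum g ψ := by
  funext b
  simp only [fiberSum, Pi.smul_apply, smul_finsum]

theorem FiniteFibers.add {g : A → B} {ψ φ : A → ℝ} (hψ : FiniteFibers g ψ)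
    (hφ : FiniteFibers g φ) : FiniteFibers g (ψ + φ) := by
  intro b
  refine ((hψ b).union (hφ b)).subset ?_
  rintro x ⟨h1, h2⟩
  by_cases h : ψ x = 0
  · exact Or.inr ⟨h1, fun h' => h2 (by simp [h, h'])⟩
  · exact Or.inl ⟨h1, h⟩

theorem FiniteFibers.smul {g : A → B} {ψ : A → ℝ} (a : ℝ) (hψ : FiniteFibers g ψ) :
    FiniteFibers g (a • ψ) := fun b =>
  (hψ b).subset fun _ hx => ⟨hx.1, fun h => hx.2 (by simp [h])⟩

theorem finiteFibers_zero (g : A → B) : FiniteFibers g (0 : A → ℝ) := fun _ => by simp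

theorem finiteFibers_sum {ι : Type*} (g : A → B) (s : Finset ι) (ψ : ι → A → ℝ)
    (h : ∀ i ∈ s, FiniteFibers g (ψ i)) : FiniteFibers g (∑ i ∈ s, ψ i) :=
  Finset.sum_induction ψ (FiniteFibers g) (fun _ _ => FiniteFibers.add) (finiteFibers_zero g) h

theorem fiberSum_sum {ι : Type*} (g : A → B) (s : Finset ι) (ψ : ι → A → ℝ)
    (h : ∀ i ∈ s, FiniteFibers g (ψ i)) :
    fiberSum g (∑ i ∈ s, ψ i) = ∑ i ∈ s, fiberSum g (ψ i) := by
  classical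
  induction s using Finset.induction_on with
  | empty => simpa using fiberSum_smul g 0 0
  | insert i s hi ih =>
    rw [Finset.sum_insert hi, Finset.sum_insert hi, fiberSum_add,
      ih fun j hj => h j (Finset.mem_insert_of_mem hj)]
    · exact h i (Finset.mem_insert_self i s)
    · exact finiteFibers_sum g s ψ fun j hj => h j (Finset.mem_insert_of_mem hj)

end FiberSum

/-- The alternating condition for functions on tuples. -/
def IsAlt {X : Type*} {n : ℕ} (ψ : (Fin n → X) → ℝ) : Prop :=
  ∀ (σ : Equiv.Perm (Fin n)) (x : Fin n → X), ψ (x ∘ σ) = ((Equiv.Perm.sign σ : ℤ) : ℝ) * ψ x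

/-- The sign of a permutation as a real number. -/
def realSign {n : ℕ} (σ : Equiv.Perm (Fin n)) : ℝ := ((Equiv.Perm.sign σ : ℤ) : ℝ)

theorem realSign_mul {n : ℕ} (σ τ : Equiv.Perm (Fin n)) :
    realSign (σ * τ) = realSign σ * realSign τ := by
  simp [realSign]

theorem realSign_inv {n : ℕ} (σ : Equiv.Perm (Fin n)) : realSign σ⁻¹ = realSign σ := by
  simp [realSign]

theorem realSign_mul_self {n : ℕ} (σ : Equiv.Perm (Fin n)) : realSign σ * realSign σ = 1 := by
  rw [realSign, ← Int.cast_mul, ← Units.val_mul, Int.units_mul_self]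
  simp

theorem abs_realSign {n : ℕ} (σ : Equiv.Perm (Fin n)) : |realSign σ| = 1 := by
  rcases Int.units_eq_one_or (Equiv.Perm.sign σ) with h | h <;> simp [realSign, h]

theorem bdN_eq_fiberSum {X : Type*} (n : ℕ) (ψ : (Fin (n + 2) → X) → ℝ) :
    bdN n ψ = fiberSum (fun x => x ∘ Fin.succ) ψ := by
  funext x
  have hr : {z : Fin (n + 2) → X | z ∘ Fin.succ = x} =
      Set.range (fun y : X => (Fin.cons y x : Fin (n + 2) → X)) := by
    ext z
    constructor
    · rintro rfl
      exact ⟨z 0, Fin.cons_self_tail z⟩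
    · rintro ⟨y, rfl⟩
      rfl
  have h := finsum_mem_range (f := ψ) (g := fun y : X => (Fin.cons y x : Fin (n + 2) → X))
    (Fin.cons_left_injective (α := fun _ => X) x)
  rw [← hr] at h
  exact h.symm

theorem fiberSum_perm {X : Type*} {n : ℕ} {ψ : (Fin n → X) → ℝ} (hψ : IsAlt ψ)
    (σ : Equiv.Perm (Fin n)) : fiberSum (fun x => x ∘ σ) ψ = realSign σ • ψ := by
  funext y
  have hs : {x : Fin n → X | x ∘ σ = y} = {y ∘ (σ⁻¹ : Equiv.Perm (Fin n))} := by
    ext x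
    constructor
    · rintro rfl
      funext k
      simp
    · rintro rfl
      funext k
      simp
  have h : fiberSum (fun x => x ∘ σ) ψ y = ∑ᶠ x ∈ {x : Fin n → X | x ∘ σ = y}, ψ x := rfl
  rw [h, hs, finsum_mem_singleton, hψ]
  change realSign σ⁻¹ * _ = _
  rw [realSign_inv]
  rfl

section Push

variable {X Y : Type*} (E : Bool → X → Y)

/-- The map of tuples whose `k`-th output is `E (β k)` applied to the `s k`-th input. -/
def mixMap {a b : ℕ} (β : Fin a → Bool) (s : Fin a → Fin b) (x : Fin b → X) : Fin a → Y :=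
  fun k => E (β k) (x (s k))

/-- The antisymmetrization of the pushforward along `mixMap E β s`. -/
noncomputable def altPush {a b : ℕ} (β : Fin a → Bool) (s : Fin a → Fin b)
    (ψ : (Fin b → X) → ℝ) : (Fin a → Y) → ℝ :=
  ∑ σ : Equiv.Perm (Fin a), realSign σ • fiberSum (mixMap E (β ∘ σ) (s ∘ σ)) ψ

theorem altPush_comp_perm {a b : ℕ} (β : Fin a → Bool) (s : Fin a → Fin b)
    (ψ : (Fin b → X) → ℝ) (ρ : Equiv.Perm (Fin a)) :
    altPush E (β ∘ ρ) (s ∘ ρ) ψ = realSign ρ • altPush E β s ψ := by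
  unfold altPush
  rw [Finset.smul_sum]
  refine Fintype.sum_equiv (Equiv.mulLeft ρ) _ _ fun σ => ?_
  rw [Equiv.coe_mulLeft, realSign_mul, smul_smul, ← mul_assoc, realSign_mul_self, one_mul]
  rfl

theorem altPush_comp_right {a b c : ℕ} (β : Fin a → Bool) (s : Fin a → Fin b)
    (t : Fin b → Fin c) (ψ : (Fin c → X) → ℝ)
    (hf : ∀ (γ : Fin a → Bool) (r : Fin a → Fin c), FiniteFibers (mixMap E γ r) ψ) :
    altPush E β (t ∘ s) ψ = altPush E β s (fiberSum (fun x => x ∘ t) ψ) := by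
  unfold altPush
  refine Finset.sum_congr rfl fun σ _ => ?_
  rw [fiberSum_comp (mixMap E (β ∘ σ) (s ∘ σ)) (fun x => x ∘ t) ψ (hf (β ∘ σ) (t ∘ s ∘ σ))]
  rfl

theorem altPush_perm_id {n : ℕ} (β : Fin n → Bool) (ρ : Equiv.Perm (Fin n))
    {ψ : (Fin n → X) → ℝ} (hψ : IsAlt ψ)
    (hf : ∀ (γ : Fin n → Bool) (r : Fin n → Fin n), FiniteFibers (mixMap E γ r) ψ) :
    altPush E (β ∘ ρ) id ψ = altPush E β id ψ := by
  have hid : (id : Fin n → Fin n) = (ρ⁻¹ : Equiv.Perm (Fin n)) ∘ ρ := by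
    funext k
    simp
  rw [hid, altPush_comp_perm, ← hid, ← Function.comp_id ⇑(ρ⁻¹ : Equiv.Perm (Fin n)),
    altPush_comp_right E β id _ ψ hf, fiberSum_perm hψ, realSign_inv]
  unfold altPush
  simp only [fiberSum_smul, Finset.smul_sum]
  refine Finset.sum_congr rfl fun σ _ => ?_
  rw [smul_comm (realSign σ), smul_smul, realSign_mul_self, one_smul]

theorem altPush_const {n : ℕ} (c : Bool) {ψ : (Fin n → X) → ℝ} (hψ : IsAlt ψ)
    (hf : ∀ (γ : Fin n → Bool) (r : Fin n → Fin n), FiniteFibers (mixMap E γ r) ψ) :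
    altPush E (fun _ => c) id ψ = (n.factorial : ℝ) • fiberSum (fun x => E c ∘ x) ψ := by
  have h : ∀ σ : Equiv.Perm (Fin n),
      realSign σ • fiberSum (mixMap E ((fun _ => c) ∘ σ) (id ∘ σ)) ψ =
        fiberSum (fun x => E c ∘ x) ψ := by
    intro σ
    have h1 := fiberSum_comp (fun x : Fin n → X => E c ∘ x) (fun x => x ∘ σ) ψ
      (hf (fun _ => c) σ)
    rw [fiberSum_perm hψ, fiberSum_smul] at h1
    have h2 : mixMap E ((fun _ => c) ∘ σ) (id ∘ σ) =
      (fun x : Fin n → X => E c ∘ x) ∘ fun x => x ∘ σ := rfl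
    rw [h2, ← h1, smul_smul, realSign_mul_self, one_smul]
  unfold altPush
  rw [Finset.sum_congr rfl fun σ _ => h σ, Finset.sum_const, Finset.card_univ,
    Fintype.card_perm, Fintype.card_fin, Nat.cast_smul_eq_nsmul]

end Push

/-- Extend a permutation of `Fin n` to one of `Fin (n + 1)` sending `0` to `p`. -/
def insertPerm {n : ℕ} (p : Fin (n + 1)) (τ : Equiv.Perm (Fin n)) : Equiv.Perm (Fin (n + 1)) :=
  p.cycleRange.symm * Equiv.Perm.decomposeFin.symm (0, τ)

theorem insertPerm_zero {n : ℕ} (p : Fin (n + 1)) (τ : Equiv.Perm (Fin n)) :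
    insertPerm p τ 0 = p := by
  simp [insertPerm]

theorem insertPerm_succ {n : ℕ} (p : Fin (n + 1)) (τ : Equiv.Perm (Fin n)) (k : Fin n) :
    insertPerm p τ k.succ = p.succAbove (τ k) := by
  simp [insertPerm]

theorem realSign_insertPerm {n : ℕ} (p : Fin (n + 1)) (τ : Equiv.Perm (Fin n)) :
    realSign (insertPerm p τ) = (-1) ^ (p : ℕ) * realSign τ := by
  simp [insertPerm, realSign, Equiv.Perm.decomposeFin.symm_sign]

theorem insertPerm_bijective (n : ℕ) :
    Function.Bijective fun z : Fin (n + 1) × Equiv.Perm (Fin n) => insertPerm z.1 z.2 := by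
  rw [Fintype.bijective_iff_injective_and_card]
  constructor
  · rintro ⟨p, τ⟩ ⟨p', τ'⟩ h
    have hp : p = p' := by
      rw [← insertPerm_zero p τ, ← insertPerm_zero p' τ']
      exact congrArg (fun σ : Equiv.Perm (Fin (n + 1)) => σ 0) h
    subst hp
    refine Prod.ext rfl (Equiv.ext fun k => p.succAbove_right_injective ?_)
    rw [← insertPerm_succ, ← insertPerm_succ]
    exact congrArg (fun σ : Equiv.Perm (Fin (n + 1)) => σ k.succ) h
  · simp [Fintype.card_perm, Nat.factorial_succ]

section Boundary

variable {X Y : Type*} (E : Bool → X → Y)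

theorem bdN_altPush {n b : ℕ} (β : Fin (n + 2) → Bool) (s : Fin (n + 2) → Fin b)
    (ψ : (Fin b → X) → ℝ)
    (hf : ∀ (γ : Fin (n + 1) → Bool) (r : Fin (n + 1) → Fin b), FiniteFibers (mixMap E γ r) ψ) :
    bdN n (altPush E β s ψ) = ∑ p : Fin (n + 2),
      (-1 : ℝ) ^ (p : ℕ) • altPush E (β ∘ p.succAbove) (s ∘ p.succAbove) ψ := by
  have hc : ∀ σ : Equiv.Perm (Fin (n + 2)), FiniteFibers
      ((fun x : Fin (n + 2) → Y => x ∘ Fin.succ) ∘ mixMap E (β ∘ σ) (s ∘ σ)) ψ := fun σ =>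
    hf (β ∘ σ ∘ Fin.succ) (s ∘ σ ∘ Fin.succ)
  rw [bdN_eq_fiberSum]
  unfold altPush
  rw [fiberSum_sum _ _ _ fun σ _ => (hc σ).fiberSum.smul _,
    ← Fintype.sum_bijective _ (insertPerm_bijective (n + 1)) _ _ fun _ => rfl,
    Fintype.sum_prod_type]
  refine Finset.sum_congr rfl fun p _ => ?_
  rw [Finset.smul_sum]
  refine Finset.sum_congr rfl fun τ _ => ?_
  rw [fiberSum_smul, fiberSum_comp _ _ _ (hc _), realSign_insertPerm, smul_smul]
  congr 2
  funext x k
  simp [mixMap, insertPerm_succ]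

theorem fiberSum_succAbove {n : ℕ} (q : Fin (n + 2)) {ψ : (Fin (n + 2) → X) → ℝ}
    (hψ : IsAlt ψ)
    (hf : ∀ r : Fin (n + 1) → Fin (n + 2), FiniteFibers (fun x : Fin (n + 2) → X => x ∘ r) ψ) :
    fiberSum (fun x => x ∘ q.succAbove) ψ = (-1 : ℝ) ^ (q : ℕ) • bdN n ψ := by
  have h := fiberSum_comp (fun x : Fin (n + 2) → X => x ∘ Fin.succ)
    (fun x => x ∘ q.cycleRange.symm) ψ (hf (q.cycleRange.symm ∘ Fin.succ))
  rw [fiberSum_perm hψ, fiberSum_smul, ← bdN_eq_fiberSum] at h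
  have hs : realSign q.cycleRange.symm = (-1) ^ (q : ℕ) := by simp [realSign]
  rw [← hs, h]
  congr 1
  funext x k
  simp

/-- The choice of maps used by the `i`-th summand of the homotopy: the first two slots are
the edge from `E true` to `E false`, followed by `i` slots `true` and then slots `false`. -/
def edgeChoice (n i : ℕ) : Fin (n + 2) → Bool :=
  Fin.cons true (Fin.cons false fun k : Fin n => decide ((k : ℕ) < i))

/-- The map `0 ↦ 0`, `k + 1 ↦ k`. -/
def collapse (n : ℕ) : Fin (n + 2) → Fin (n + 1) := Fin.cons 0 id

/-- The homotopy operator. -/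
noncomputable def homotopyOp (n : ℕ) (ψ : (Fin (n + 1) → X) → ℝ) : (Fin (n + 2) → Y) → ℝ :=
  ((n + 1).factorial : ℝ)⁻¹ •
    ∑ i ∈ Finset.range (n + 1), altPush E (edgeChoice n i) (collapse n) ψ

theorem altPush_edge_zero {n i : ℕ} (hi : i ≤ n) {ψ : (Fin (n + 1) → X) → ℝ} (hψ : IsAlt ψ)
    (hf : ∀ (γ : Fin (n + 1) → Bool) (r : Fin (n + 1) → Fin (n + 1)),
      FiniteFibers (mixMap E γ r) ψ) :
    altPush E (edgeChoice n i ∘ Fin.succAbove 0) (collapse n ∘ Fin.succAbove 0) ψ =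
      altPush E (fun k => decide ((k : ℕ) < i)) id ψ := by
  have h1 : collapse n ∘ Fin.succAbove 0 = id := by
    funext k
    simp [collapse]
  have h2 : (fun k : Fin (n + 1) => decide ((k : ℕ) < i)) =
      (edgeChoice n i ∘ Fin.succAbove 0) ∘ finRotate (n + 1) := by
    funext k
    refine Fin.lastCases ?_ (fun j => ?_) k
    · simp [edgeChoice, hi]
    · simp [edgeChoice]
  rw [h1, h2, altPush_perm_id E _ _ hψ hf]

theorem altPush_edge_one {n i : ℕ} (ψ : (Fin (n + 1) → X) → ℝ) :
    altPush E (edgeChoice n i ∘ Fin.succAbove 1) (collapse n ∘ Fin.succAbove 1) ψ =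
      altPush E (fun k => decide ((k : ℕ) < i + 1)) id ψ := by
  congr 1
  · funext k
    rw [← Fin.succ_zero_eq_one]
    refine Fin.cases ?_ (fun j => ?_) k
    · simp [edgeChoice]
    · simp only [edgeChoice, Function.comp_apply, Fin.succ_succAbove_succ, Fin.cons_succ]
      simp
  · funext k
    rw [← Fin.succ_zero_eq_one]
    refine Fin.cases ?_ (fun j => ?_) k
    · simp [collapse]
    · simp only [collapse, Function.comp_apply, Fin.succ_succAbove_succ, Fin.cons_succ]
      simp

theorem altPush_edge_succ_succ {n i : ℕ} (q : Fin (n + 1)) {ψ : (Fin (n + 2) → X) → ℝ}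
    (hψ : IsAlt ψ)
    (hf : ∀ (γ : Fin (n + 2) → Bool) (r : Fin (n + 2) → Fin (n + 2)),
      FiniteFibers (mixMap E γ r) ψ)
    (hf' : ∀ r : Fin (n + 1) → Fin (n + 2), FiniteFibers (fun x : Fin (n + 2) → X => x ∘ r) ψ) :
    altPush E (edgeChoice (n + 1) i ∘ q.succ.succ.succAbove)
        (collapse (n + 1) ∘ q.succ.succ.succAbove) ψ =
      (-1 : ℝ) ^ ((q : ℕ) + 1) •
        altPush E (edgeChoice n (if (q : ℕ) < i then i - 1 else i)) (collapse n) (bdN n ψ) := by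
  have h1 : edgeChoice (n + 1) i ∘ q.succ.succ.succAbove =
      edgeChoice n (if (q : ℕ) < i then i - 1 else i) := by
    funext k
    refine Fin.cases ?_ (fun j => Fin.cases ?_ (fun l => ?_) j) k
    · simp [edgeChoice]
    · simp only [edgeChoice, Function.comp_apply, Fin.succ_succAbove_succ, Fin.cons_succ]
      simp
    · simp only [edgeChoice, Function.comp_apply, Fin.succ_succAbove_succ, Fin.cons_succ,
        decide_eq_decide]
      rcases lt_or_ge l.castSucc q with h | h
      · rw [Fin.succAbove_of_castSucc_lt _ _ h]
        rw [Fin.lt_def, Fin.val_castSucc] at h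
        rw [Fin.val_castSucc]
        split_ifs <;> omega
      · rw [Fin.succAbove_of_le_castSucc _ _ h]
        rw [Fin.le_def, Fin.val_castSucc] at h
        rw [Fin.val_succ]
        split_ifs <;> omega
  have h2 : collapse (n + 1) ∘ q.succ.succ.succAbove = q.succ.succAbove ∘ collapse n := by
    funext k
    refine Fin.cases ?_ (fun j => ?_) k <;> simp [collapse]
  rw [h1, h2, altPush_comp_right E _ _ _ _ hf, fiberSum_succAbove q.succ hψ hf', Fin.val_succ]
  simp only [altPush, fiberSum_smul, Finset.smul_sum]
  exact Finset.sum_congr rfl fun σ _ => smul_comm _ _ _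

theorem bdN_smul_sum {X : Type*} {ι : Type*} (n : ℕ) (c : ℝ) (s : Finset ι)
    (ψ : ι → (Fin (n + 2) → X) → ℝ)
    (h : ∀ i ∈ s, FiniteFibers (fun x : Fin (n + 2) → X => x ∘ Fin.succ) (ψ i)) :
    bdN n (c • ∑ i ∈ s, ψ i) = c • ∑ i ∈ s, bdN n (ψ i) := by
  simp only [bdN_eq_fiberSum]
  rw [fiberSum_smul, fiberSum_sum _ _ _ h]

theorem bdN_homotopyOp {n : ℕ} {ψ : (Fin (n + 1) → X) → ℝ} (hψ : IsAlt ψ)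
    (hf : ∀ (γ : Fin (n + 1) → Bool) (r : Fin (n + 1) → Fin (n + 1)),
      FiniteFibers (mixMap E γ r) ψ) :
    bdN n (homotopyOp E n ψ) = pushf (E false) n ψ - pushf (E true) n ψ +
      ((n + 1).factorial : ℝ)⁻¹ • ∑ i ∈ Finset.range (n + 1), ∑ q : Fin n,
        (-1 : ℝ) ^ (q : ℕ) • altPush E (edgeChoice n i ∘ q.succ.succ.succAbove)
          (collapse n ∘ q.succ.succ.succAbove) ψ := by
  have hfin : ∀ i ∈ Finset.range (n + 1), FiniteFibers (fun x : Fin (n + 2) → Y => x ∘ Fin.succ)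
      (altPush E (edgeChoice n i) (collapse n) ψ) := fun i _ =>
    finiteFibers_sum _ _ _ fun σ _ => FiniteFibers.smul _ <| FiniteFibers.fiberSum <|
      hf (edgeChoice n i ∘ σ ∘ Fin.succ) (collapse n ∘ σ ∘ Fin.succ)
  set T : ℕ → (Fin (n + 1) → Y) → ℝ :=
    fun i => altPush E (fun k => decide ((k : ℕ) < i)) id ψ with hT
  have hi : ∀ i ∈ Finset.range (n + 1), bdN n (altPush E (edgeChoice n i) (collapse n) ψ) =
      (T i - T (i + 1)) + ∑ q : Fin n,
        (-1 : ℝ) ^ (q : ℕ) • altPush E (edgeChoice n i ∘ q.succ.succ.succAbove)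
          (collapse n ∘ q.succ.succ.succAbove) ψ := by
    intro i hi
    rw [bdN_altPush E _ _ _ hf, Fin.sum_univ_succ, Fin.sum_univ_succ,
      altPush_edge_zero E (Nat.lt_succ_iff.1 (Finset.mem_range.1 hi)) hψ hf, Fin.succ_zero_eq_one,
      altPush_edge_one, ← add_assoc]
    congr 1
    · simp [hT, sub_eq_add_neg]
    · refine Finset.sum_congr rfl fun q _ => ?_
      simp [pow_succ]
  have h0 : T 0 = ((n + 1).factorial : ℝ) • pushf (E false) n ψ := by
    have : T 0 = altPush E (fun _ => false) id ψ := by simp [hT]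
    rw [this, altPush_const E false hψ hf]
    rfl
  have h1 : T (n + 1) = ((n + 1).factorial : ℝ) • pushf (E true) n ψ := by
    have : T (n + 1) = altPush E (fun _ => true) id ψ := by
      have hk : (fun k : Fin (n + 1) => decide ((k : ℕ) < n + 1)) = fun _ => true := by
        funext k
        exact decide_eq_true k.2
      simp only [hT, hk]
    rw [this, altPush_const E true hψ hf]
    rfl
  have hne : ((n + 1).factorial : ℝ) ≠ 0 := Nat.cast_ne_zero.2 (Nat.factorial_ne_zero _)
  rw [homotopyOp, bdN_smul_sum n _ _ _ hfin, Finset.sum_congr rfl hi, Finset.sum_add_distrib,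
    Finset.sum_range_sub', smul_add, h0, h1, ← smul_sub, smul_smul, inv_mul_cancel₀ hne, one_smul]

theorem sum_range_sum_shift {M : Type*} [AddCommGroup M] [Module ℝ M] (m : ℕ) (V : ℕ → M) :
    ∑ i ∈ Finset.range (m + 1), ∑ q : Fin m, V (if (q : ℕ) < i then i - 1 else i) =
      ((m + 1 : ℕ) : ℝ) • ∑ j ∈ Finset.range m, V j := by
  have h : ∀ q : ℕ, ∀ k, ∑ i ∈ Finset.range (q + 1 + k), V (if q < i then i - 1 else i) =
      ∑ j ∈ Finset.range (q + k), V j + V q := by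
    intro q k
    induction k with
    | zero =>
      rw [add_zero, add_zero, ← Finset.sum_range_succ]
      refine Finset.sum_congr rfl fun i hi => ?_
      rw [if_neg (by have := Finset.mem_range.1 hi; omega)]
    | succ k ih =>
      rw [← add_assoc, Finset.sum_range_succ, ih, ← add_assoc, Finset.sum_range_succ,
        if_pos (by omega), show q + 1 + k - 1 = q + k by omega]
      abel
  rw [Finset.sum_comm]
  have hq : ∀ q : Fin m, ∑ i ∈ Finset.range (m + 1), V (if (q : ℕ) < i then i - 1 else i) =
      ∑ j ∈ Finset.range m, V j + V q := by
    intro q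
    obtain ⟨k, hk⟩ := Nat.exists_eq_add_of_lt q.2
    have := h q (k + 1)
    rwa [show (q : ℕ) + 1 + (k + 1) = m + 1 by omega, show (q : ℕ) + (k + 1) = m by omega] at this
  rw [Finset.sum_congr rfl fun q _ => hq q, Finset.sum_add_distrib, Finset.sum_const,
    Finset.card_univ, Fintype.card_fin, Fin.sum_univ_eq_sum_range, Nat.cast_smul_eq_nsmul,
    succ_nsmul]

theorem bdN_homotopyOp_zero {ψ : (Fin 1 → X) → ℝ} (hψ : IsAlt ψ)
    (hf : ∀ (γ : Fin 1 → Bool) (r : Fin 1 → Fin 1), FiniteFibers (mixMap E γ r) ψ) :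
    bdN 0 (homotopyOp E 0 ψ) = pushf (E false) 0 ψ - pushf (E true) 0 ψ := by
  rw [bdN_homotopyOp E hψ hf]
  simp

theorem bdN_homotopyOp_succ {n : ℕ} {ψ : (Fin (n + 2) → X) → ℝ} (hψ : IsAlt ψ)
    (hf : ∀ (γ : Fin (n + 2) → Bool) (r : Fin (n + 2) → Fin (n + 2)),
      FiniteFibers (mixMap E γ r) ψ)
    (hf' : ∀ r : Fin (n + 1) → Fin (n + 2), FiniteFibers (fun x : Fin (n + 2) → X => x ∘ r) ψ) :
    bdN (n + 1) (homotopyOp E (n + 1) ψ) + homotopyOp E n (bdN n ψ) =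
      pushf (E false) (n + 1) ψ - pushf (E true) (n + 1) ψ := by
  have hV : ∀ (i : ℕ) (q : Fin (n + 1)), (-1 : ℝ) ^ (q : ℕ) •
      altPush E (edgeChoice (n + 1) i ∘ q.succ.succ.succAbove)
        (collapse (n + 1) ∘ q.succ.succ.succAbove) ψ =
      (-1 : ℝ) • altPush E (edgeChoice n (if (q : ℕ) < i then i - 1 else i)) (collapse n)
        (bdN n ψ) := by
    intro i q
    rw [altPush_edge_succ_succ E q hψ hf hf', smul_smul, pow_succ, ← mul_assoc, ← mul_pow]
    simp
  rw [bdN_homotopyOp E hψ hf]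
  simp only [hV]
  simp only [← Finset.smul_sum]
  rw [sum_range_sum_shift (n + 1)
    fun j => altPush E (edgeChoice n j) (collapse n) (bdN n ψ), homotopyOp,
    Nat.factorial_succ (n + 1), Nat.cast_mul, mul_inv, smul_smul, smul_smul]
  have hc : ((n + 1 + 1 : ℕ) : ℝ)⁻¹ * ((n + 1).factorial : ℝ)⁻¹ * -1 * ((n + 1 + 1 : ℕ) : ℝ) =
      -((n + 1).factorial : ℝ)⁻¹ := by
    field_simp
  rw [hc, neg_smul]
  abel

end Boundary

section Metric

variable {X Y : Type*} [MetricSpace X] [MetricSpace Y]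

/-- A family of quasi-isometric embeddings, with common constants, that are pairwise close. -/
structure IsCloseQIFamily (E : Bool → X → Y) (A B D : ℝ) : Prop where
  one_le : 1 ≤ A
  nonneg : 0 ≤ B
  lower : ∀ b x x', dist x x' ≤ A * (dist (E b x) (E b x') + B)
  upper : ∀ b x x', dist (E b x) (E b x') ≤ A * dist x x' + B
  close : ∀ b b' x, dist (E b x) (E b' x) ≤ D

theorem BddGeom.exists_ncard_le (hX : BddGeom X) (D : ℝ) (n : ℕ) :
    ∃ N : ℕ, ∀ (x₀ : Fin n → X) (S : Set (Fin n → X)), (∀ x ∈ S, ∀ k, dist (x k) (x₀ k) ≤ D) →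
      S.Finite ∧ S.ncard ≤ N := by
  classical
  obtain ⟨N, hN⟩ := hX (max D 1) (lt_max_of_lt_right one_pos)
  refine ⟨N ^ n, fun x₀ S hS => ?_⟩
  set T : Finset (Fin n → X) := Fintype.piFinset fun k => (hN (x₀ k)).1.toFinset with hT
  have hsub : S ⊆ T := by
    intro x hx
    rw [hT, Finset.mem_coe, Fintype.mem_piFinset]
    intro k
    simpa using Or.inl (hS x hx k)
  refine ⟨T.finite_toSet.subset hsub, (Set.ncard_le_ncard hsub T.finite_toSet).trans ?_⟩
  rw [Set.ncard_coe_finset, hT, Fintype.card_piFinset]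
  calc ∏ k, (hN (x₀ k)).1.toFinset.card ≤ ∏ _k : Fin n, N :=
        Finset.prod_le_prod' fun k _ => by
          rw [← Set.ncard_eq_toFinset_card _ (hN (x₀ k)).1]
          exact (hN (x₀ k)).2
    _ = N ^ n := by simp

/-- A function of finite propagation has finite fibres along any map that determines one
coordinate up to a bounded error. -/
theorem BddGeom.finiteFibers {Z : Type*} (hX : BddGeom X) {n : ℕ} {ψ : (Fin n → X) → ℝ} {R : ℝ}
    (hR : ∀ x, (∃ i j, R < dist (x i) (x j)) → ψ x = 0) (g : (Fin n → X) → Z) (k₀ : Fin n) (D : ℝ)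
    (hg : ∀ x x', g x = g x' → dist (x k₀) (x' k₀) ≤ D) : FiniteFibers g ψ := by
  intro z
  rcases Set.eq_empty_or_nonempty {x | g x = z ∧ ψ x ≠ 0} with h | ⟨x₀, hx₀⟩
  · rw [h]
    exact Set.finite_empty
  · have hR' : ∀ x, ψ x ≠ 0 → ∀ i j, dist (x i) (x j) ≤ R := by
      intro x hx i j
      by_contra! h
      exact hx (hR x ⟨i, j, h⟩)
    obtain ⟨N, hN⟩ := hX.exists_ncard_le (R + D + R) n
    refine (hN x₀ _ fun x hx k => ?_).1
    calc dist (x k) (x₀ k) ≤ dist (x k) (x k₀) + dist (x k₀) (x₀ k₀) + dist (x₀ k₀) (x₀ k) :=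
          dist_triangle4 _ _ _ _
      _ ≤ R + D + R := by
          gcongr
          · exact hR' x hx.2 _ _
          · exact hg x x₀ (hx.1.trans hx₀.1.symm)
          · exact hR' x₀ hx₀.2 _ _

theorem IsControlFun.exists_affine_le {f : ℝ → ℝ} (hf : IsControlFun f) {A D : ℝ} (hA : 0 < A)
    (hD : 0 ≤ D) : ∃ L > (0 : ℝ), ∀ s, 0 ≤ s → f (A * s + D) ≤ L * f s := by
  obtain ⟨L₁, hL₁, h₁⟩ := hf.shift (D + 1) (by linarith)
  obtain ⟨L₂, hL₂, h₂⟩ := hf.scale A hA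
  have hfD := hf.nonneg D hD
  refine ⟨L₁ * L₂ + f D, by positivity, fun s hs => ?_⟩
  have hfs := hf.nonneg s hs
  rcases hs.eq_or_lt with rfl | hs'
  · rw [mul_zero, zero_add, hf.one_at_zero]
    nlinarith [mul_pos hL₁ hL₂]
  · calc f (A * s + D) ≤ f (A * s + (D + 1)) :=
          hf.mono _ _ (by positivity) (by linarith)
      _ ≤ L₁ * f (A * s) := h₁ _ (by positivity)
      _ ≤ L₁ * (L₂ * f s) := mul_le_mul_of_nonneg_left (h₂ s hs') hL₁.le
      _ ≤ (L₁ * L₂ + f D) * f s := by nlinarith [mul_nonneg hfD hfs]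

theorem IsNChain.add {e : X} {f : ℝ → ℝ} {n : ℕ}
    {ψ φ : (Fin (n + 1) → X) → ℝ} (hψ : IsNChain e f n ψ) (hφ : IsNChain e f n φ) :
    IsNChain e f n (ψ + φ) := by
  obtain ⟨a₁, ⟨R₁, hR₁, p₁⟩, K₁, hK₁, g₁⟩ := hψ
  obtain ⟨a₂, ⟨R₂, hR₂, p₂⟩, K₂, hK₂, g₂⟩ := hφ
  refine ⟨fun σ x => ?_, ⟨max R₁ R₂, lt_max_of_lt_left hR₁, ?_⟩, K₁ + K₂, by positivity,
    fun x => ?_⟩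
  · rw [Pi.add_apply, Pi.add_apply, a₁, a₂, mul_add]
  · rintro x ⟨i, j, h⟩
    rw [Pi.add_apply, p₁ x ⟨i, j, (le_max_left _ _).trans_lt h⟩,
      p₂ x ⟨i, j, (le_max_right _ _).trans_lt h⟩, add_zero]
  · rw [add_mul]
    exact (abs_add_le _ _).trans (add_le_add (g₁ x) (g₂ x))

theorem IsNChain.smul {e : X} {f : ℝ → ℝ} (hf : IsControlFun f) {n : ℕ} (c : ℝ)
    {ψ : (Fin (n + 1) → X) → ℝ} (hψ : IsNChain e f n ψ) : IsNChain e f n (c • ψ) := by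
  obtain ⟨a, ⟨R, hR, p⟩, K, hK, g⟩ := hψ
  refine ⟨fun σ x => ?_, ⟨R, hR, fun x hx => ?_⟩, (|c| + 1) * K, by positivity, fun x => ?_⟩
  · rw [Pi.smul_apply, Pi.smul_apply, a, smul_eq_mul, smul_eq_mul, mul_left_comm]
  · rw [Pi.smul_apply, p x hx, smul_zero]
  · have hs : 0 ≤ f (⨆ i, dist (x i) e) := hf.nonneg _ (Real.iSup_nonneg fun _ => dist_nonneg)
    rw [Pi.smul_apply, smul_eq_mul, abs_mul, mul_assoc]
    exact mul_le_mul (by linarith) (g x) (abs_nonneg _) (by positivity)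

theorem isNChain_zero {e : X} {f : ℝ → ℝ} (hf : IsControlFun f) (n : ℕ) :
    IsNChain e f n (0 : (Fin (n + 1) → X) → ℝ) :=
  ⟨by simp, ⟨1, one_pos, by simp⟩, 1, one_pos, fun x => by
    simpa using hf.nonneg _ (Real.iSup_nonneg fun i => dist_nonneg (x := x i) (y := e))⟩

variable {E : Bool → X → Y} {A B D : ℝ}

theorem IsCloseQIFamily.dist_le_of_eq (hE : IsCloseQIFamily E A B D) {c : Bool} {x x' : X}
    (h : E c x = E c x') : dist x x' ≤ A * B := by
  have := hE.lower c x x'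
  rwa [h, dist_self, zero_add] at this

theorem IsCloseQIFamily.finiteFibers_mixMap (hE : IsCloseQIFamily E A B D) (hX : BddGeom X)
    {a b : ℕ} {ψ : (Fin b → X) → ℝ} {R : ℝ}
    (hR : ∀ x, (∃ i j, R < dist (x i) (x j)) → ψ x = 0)
    (β : Fin (a + 1) → Bool) (s : Fin (a + 1) → Fin b) : FiniteFibers (mixMap E β s) ψ :=
  hX.finiteFibers hR _ (s 0) (A * B) fun _ _ h => hE.dist_le_of_eq (congrFun h 0)

theorem IsCloseQIFamily.exists_ncard_fiber_le (hE : IsCloseQIFamily E A B D) (hX : BddGeom X)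
    (a b : ℕ) : ∃ N : ℕ, ∀ (β : Fin a → Bool) (s : Fin a → Fin b), Function.Surjective s →
      ∀ y, {x | mixMap E β s x = y}.Finite ∧ {x | mixMap E β s x = y}.ncard ≤ N := by
  obtain ⟨N, hN⟩ := hX.exists_ncard_le (A * B) b
  refine ⟨N, fun β s hs y => ?_⟩
  rcases Set.eq_empty_or_nonempty {x | mixMap E β s x = y} with h | ⟨x₀, hx₀⟩
  · rw [h]
    simp
  · refine hN x₀ _ fun x hx k => ?_
    obtain ⟨j, rfl⟩ := hs k
    exact hE.dist_le_of_eq (congrFun (Eq.trans hx hx₀.symm : mixMap E β s x = mixMap E β s x₀) j)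

theorem isAlt_altPush {X Y : Type*} (E : Bool → X → Y) {a b : ℕ} (β : Fin a → Bool)
    (s : Fin a → Fin b) (ψ : (Fin b → X) → ℝ) : IsAlt (altPush E β s ψ) := by
  intro ρ y
  change _ = realSign ρ * _
  simp only [altPush, Finset.sum_apply, Pi.smul_apply, smul_eq_mul, Finset.mul_sum]
  refine Fintype.sum_equiv (Equiv.mulRight ρ⁻¹) _ _ fun σ => ?_
  rw [Equiv.coe_mulRight, realSign_mul, realSign_inv, ← mul_assoc, mul_left_comm,
    realSign_mul_self, mul_one]
  congr 1
  have h : ∀ x, mixMap E (β ∘ σ) (s ∘ σ) x = y ∘ ρ ↔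
      mixMap E (β ∘ (σ * ρ⁻¹ : Equiv.Perm (Fin a))) (s ∘ (σ * ρ⁻¹ : Equiv.Perm (Fin a))) x =
        y := by
    intro x
    constructor
    · intro h
      funext k
      simpa [mixMap] using congrFun h (ρ⁻¹ k)
    · rintro rfl
      funext k
      simp [mixMap]
  simp only [fiberSum, h]

theorem IsCloseQIFamily.dist_mixMap_le (hE : IsCloseQIFamily E A B D) {a b : ℕ}
    (β : Fin a → Bool) (s : Fin a → Fin b) (x : Fin b → X) {R : ℝ}
    (hx : ∀ i j, dist (x i) (x j) ≤ R) (i j : Fin a) :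
    dist (mixMap E β s x i) (mixMap E β s x j) ≤ D + (A * R + B) :=
  (dist_triangle _ (E (β j) (x (s i))) _).trans <| add_le_add (hE.close _ _ _) <|
    (hE.upper _ _ _).trans <| by
      have := hE.one_le
      gcongr
      exact hx _ _

theorem IsCloseQIFamily.exists_abs_fiberSum_le (hE : IsCloseQIFamily E A B D) (hX : BddGeom X)
    {eX : X} (eY : Y) {f : ℝ → ℝ} (hf : IsControlFun f) {a b : ℕ} {ψ : (Fin (b + 1) → X) → ℝ}
    (hψ : IsNChain eX f b ψ) : ∃ K > (0 : ℝ), ∀ (β : Fin (a + 1) → Bool)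
      (s : Fin (a + 1) → Fin (b + 1)), Function.Surjective s → ∀ y,
      |fiberSum (mixMap E β s) ψ y| ≤ K * f (⨆ i, dist (y i) eY) := by
  classical
  obtain ⟨-, -, K, hK, hgrow⟩ := hψ
  obtain ⟨N, hN⟩ := hE.exists_ncard_fiber_le hX (a + 1) (b + 1)
  have hA := hE.one_le
  have hB := hE.nonneg
  set M : ℝ := dist (E true eX) eY + dist (E false eX) eY with hM
  have hM0 : 0 ≤ M := by positivity
  have hbase : ∀ c, dist eY (E c eX) ≤ M := by
    rintro (_ | _) <;> rw [dist_comm, hM] <;> simp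
  obtain ⟨L, hL, hfL⟩ := hf.exists_affine_le (A := A) (D := A * (M + B)) (by positivity)
    (by positivity)
  refine ⟨(N + 1) * (K * L), by positivity, fun β s hs y => ?_⟩
  set S := ⨆ i, dist (y i) eY with hS
  have hS0 : 0 ≤ S := Real.iSup_nonneg fun _ => dist_nonneg
  have hpt : ∀ x, mixMap E β s x = y → |ψ x| ≤ K * L * f S := by
    rintro x hx
    have hsup : ⨆ k, dist (x k) eX ≤ A * S + A * (M + B) := by
      refine ciSup_le fun k => ?_
      obtain ⟨j, rfl⟩ := hs k
      have hj : E (β j) (x (s j)) = y j := congrFun hx j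
      have hyS : dist (y j) eY ≤ S :=
        le_ciSup (f := fun i => dist (y i) eY) (Set.finite_range _).bddAbove j
      calc dist (x (s j)) eX ≤ A * (dist (E (β j) (x (s j))) (E (β j) eX) + B) := hE.lower _ _ _
        _ ≤ A * ((S + M) + B) := by
            rw [hj]
            gcongr
            exact (dist_triangle _ eY _).trans (add_le_add hyS (hbase _))
        _ = A * S + A * (M + B) := by ring
    calc |ψ x| ≤ K * f (⨆ k, dist (x k) eX) := hgrow x
      _ ≤ K * (L * f S) := by
          refine mul_le_mul_of_nonneg_left ((hf.mono _ _ ?_ hsup).trans (hfL S hS0)) hK.le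
          exact Real.iSup_nonneg fun _ => dist_nonneg
      _ = K * L * f S := by ring
  obtain ⟨hfin, hcard⟩ := hN β s hs y
  rw [fiberSum_eq_sum _ ψ y hfin.toFinset fun x hx _ => by simpa using hx,
    Finset.filter_true_of_mem fun x hx => by simpa using hx]
  have hfS := hf.nonneg S hS0
  calc |∑ x ∈ hfin.toFinset, ψ x| ≤ ∑ x ∈ hfin.toFinset, |ψ x| := Finset.abs_sum_le_sum_abs _ _
    _ ≤ hfin.toFinset.card • (K * L * f S) :=
        Finset.sum_le_card_nsmul _ _ _ fun x hx => hpt x (by simpa using hx)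
    _ ≤ (N + 1) * (K * L * f S) := by
        rw [nsmul_eq_mul]
        refine mul_le_mul_of_nonneg_right ?_ (by positivity)
        rw [← Set.ncard_eq_toFinset_card _ hfin]
        exact_mod_cast hcard.trans (Nat.le_succ N)
    _ = (N + 1) * (K * L) * f S := by ring

theorem IsCloseQIFamily.isNChain_altPush (hE : IsCloseQIFamily E A B D) (hX : BddGeom X)
    {eX : X} (eY : Y) {f : ℝ → ℝ} (hf : IsControlFun f) {a b : ℕ} {ψ : (Fin (b + 1) → X) → ℝ}
    (hψ : IsNChain eX f b ψ) (β : Fin (a + 1) → Bool) {s : Fin (a + 1) → Fin (b + 1)}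
    (hs : Function.Surjective s) : IsNChain eY f a (altPush E β s ψ) := by
  obtain ⟨K, hK, hbound⟩ := hE.exists_abs_fiberSum_le hX eY hf (a := a) hψ
  obtain ⟨-, ⟨R, hR, hprop⟩, -⟩ := hψ
  have hA := hE.one_le
  have hB := hE.nonneg
  refine ⟨isAlt_altPush E β s ψ, ⟨|D| + (A * R + B), by positivity, ?_⟩,
    ((a + 1).factorial : ℝ) * K, by positivity, fun y => ?_⟩
  · rintro y ⟨i, j, hij⟩
    rw [altPush, Finset.sum_apply]
    refine Finset.sum_eq_zero fun σ _ => ?_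
    by_contra hne
    obtain ⟨x, rfl, hx⟩ := exists_of_fiberSum_ne_zero (right_ne_zero_of_mul hne)
    have := hE.dist_mixMap_le (β ∘ σ) (s ∘ σ) x (R := R)
      (fun k l => not_lt.1 fun h => hx (hprop x ⟨k, l, h⟩)) i j
    linarith [le_abs_self D]
  · rw [altPush, Finset.sum_apply]
    calc |∑ σ, (realSign σ • fiberSum (mixMap E (β ∘ σ) (s ∘ σ)) ψ) y|
        ≤ ∑ σ, |(realSign σ • fiberSum (mixMap E (β ∘ σ) (s ∘ σ)) ψ) y| :=
          Finset.abs_sum_le_sum_abs _ _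
      _ ≤ ∑ _σ : Equiv.Perm (Fin (a + 1)), K * f (⨆ i, dist (y i) eY) := by
          refine Finset.sum_le_sum fun σ _ => ?_
          rw [Pi.smul_apply, smul_eq_mul, abs_mul, abs_realSign, one_mul]
          exact hbound _ _ (hs.comp σ.surjective) y
      _ = ((a + 1).factorial : ℝ) * K * f (⨆ i, dist (y i) eY) := by
          rw [Finset.sum_const, Finset.card_univ, Fintype.card_perm, Fintype.card_fin,
            nsmul_eq_mul, mul_assoc]

theorem collapse_surjective (n : ℕ) : Function.Surjective (collapse n) :=
  fun k => ⟨k.succ, by simp [collapse]⟩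

theorem IsCloseQIFamily.isNChain_homotopyOp (hE : IsCloseQIFamily E A B D) (hX : BddGeom X)
    {eX : X} (eY : Y) {f : ℝ → ℝ} (hf : IsControlFun f) {n : ℕ} {ψ : (Fin (n + 1) → X) → ℝ}
    (hψ : IsNChain eX f n ψ) : IsNChain eY f (n + 1) (homotopyOp E n ψ) :=
  .smul hf _ <| Finset.sum_induction _ (IsNChain eY f (n + 1)) (fun _ _ => .add)
    (isNChain_zero hf _) fun _ _ => hE.isNChain_altPush hX eY hf hψ _ (collapse_surjective n)

theorem IsCloseQIFamily.homotopyOp_linear (hE : IsCloseQIFamily E A B D) (hX : BddGeom X) (n : ℕ)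
    (c d : ℝ) (ψ φ : (Fin (n + 1) → X) → ℝ) :
    homotopyOp E n (c • ψ + d • φ) = c • homotopyOp E n ψ + d • homotopyOp E n φ := by
  obtain ⟨N, hN⟩ := hE.exists_ncard_fiber_le hX (n + 2) (n + 1)
  have hfin : ∀ (β : Fin (n + 2) → Bool) (σ : Equiv.Perm (Fin (n + 2)))
      (θ : (Fin (n + 1) → X) → ℝ), FiniteFibers (mixMap E (β ∘ σ) (collapse n ∘ σ)) θ :=
    fun β σ θ y => ((hN _ _ ((collapse_surjective n).comp σ.surjective) y).1).subset
      fun _ hx => hx.1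
  have hpush : ∀ β : Fin (n + 2) → Bool, altPush E β (collapse n) (c • ψ + d • φ) =
      c • altPush E β (collapse n) ψ + d • altPush E β (collapse n) φ := by
    intro β
    simp only [altPush, Finset.smul_sum, ← Finset.sum_add_distrib]
    refine Finset.sum_congr rfl fun σ _ => ?_
    rw [fiberSum_add _ (hfin β σ _) (hfin β σ _), fiberSum_smul, fiberSum_smul, smul_add,
      smul_comm (realSign σ) c, smul_comm (realSign σ) d]
  simp only [homotopyOp, hpush, Finset.sum_add_distrib, ← Finset.smul_sum, smul_add]
  rw [smul_comm _ c, smul_comm _ d]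

theorem QIEmb.exists_isCloseQIFamily {F F' : X → Y} (hF : QIEmb F) (hF' : QIEmb F')
    (hclose : ∃ C : ℝ, ∀ x : X, dist (F x) (F' x) ≤ C) :
    ∃ A B D, IsCloseQIFamily (fun b => cond b F F') A B D := by
  obtain ⟨A₁, hA₁, B₁, hB₁, h₁⟩ := hF
  obtain ⟨A₂, hA₂, B₂, hB₂, h₂⟩ := hF'
  obtain ⟨C, hC⟩ := hclose
  have key : ∀ {G : X → Y} {A B : ℝ}, 1 ≤ A → 0 ≤ B → A ≤ max A₁ A₂ → B ≤ max B₁ B₂ →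
      (∀ x y, A⁻¹ * dist x y - B ≤ dist (G x) (G y) ∧ dist (G x) (G y) ≤ A * dist x y + B) →
      ∀ x y, dist x y ≤ max A₁ A₂ * (dist (G x) (G y) + max B₁ B₂) ∧
        dist (G x) (G y) ≤ max A₁ A₂ * dist x y + max B₁ B₂ := by
    intro G A B hA hB hA' hB' h x y
    constructor
    · calc dist x y = A * (A⁻¹ * dist x y) := by field_simp
        _ ≤ A * (dist (G x) (G y) + B) :=
            mul_le_mul_of_nonneg_left (by linarith [(h x y).1]) (by linarith)
        _ ≤ _ := by gcongr
    · exact (h x y).2.trans (by gcongr)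
  have k₁ := key hA₁ hB₁ (le_max_left _ _) (le_max_left _ _) h₁
  have k₂ := key hA₂ hB₂ (le_max_right _ _) (le_max_right _ _) h₂
  refine ⟨max A₁ A₂, max B₁ B₂, max C 0, le_max_of_le_left hA₁, le_max_of_le_left hB₁, ?_, ?_, ?_⟩
  · rintro (_ | _) x y
    exacts [(k₂ x y).1, (k₁ x y).1]
  · rintro (_ | _) x y
    exacts [(k₂ x y).2, (k₁ x y).2]
  · rintro (_ | _) (_ | _) x
    · simp
    · simpa [dist_comm] using Or.inl (hC x)
    · simpa using Or.inl (hC x)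
    · simp

end Metric

/-- Close quasi-isometric embeddings induce chain homotopic
pushforward maps on controlled chains. -/
theorem close_QI_embeddings_chain_homotopic
    {X Y : Type*} [MetricSpace X] [MetricSpace Y] (eX : X) (eY : Y) (f : ℝ → ℝ)
    (hudX : UnifDiscrete X) (hbgX : BddGeom X)
    (hudY : UnifDiscrete Y) (hbgY : BddGeom Y)
    (hf : IsControlFun f)
    (F F' : X → Y) (hF : QIEmb F) (hF' : QIEmb F')
    (hclose : ∃ C : ℝ, ∀ x : X, dist (F x) (F' x) ≤ C) :
    ∃ H : (n : ℕ) → ((Fin (n + 1) → X) → ℝ) → ((Fin (n + 2) → Y) → ℝ),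
      (∀ n (a b : ℝ) (ψ φ : (Fin (n + 1) → X) → ℝ),
        H n (a • ψ + b • φ) = a • H n ψ + b • H n φ) ∧
      (∀ n (ψ : (Fin (n + 1) → X) → ℝ), IsNChain eX f n ψ →
        IsNChain eY f (n + 1) (H n ψ)) ∧
      (∀ ψ : (Fin 1 → X) → ℝ, IsNChain eX f 0 ψ →
        bdN 0 (H 0 ψ) = pushf F' 0 ψ - pushf F 0 ψ) ∧
      (∀ n (ψ : (Fin (n + 2) → X) → ℝ), IsNChain eX f (n + 1) ψ →
        bdN (n + 1) (H (n + 1) ψ) + H n (bdN n ψ) =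
          pushf F' (n + 1) ψ - pushf F (n + 1) ψ) := by
  obtain ⟨A, B, D, hE⟩ := hF.exists_isCloseQIFamily hF' hclose
  refine ⟨homotopyOp fun b => cond b F F', hE.homotopyOp_linear hbgX,
    fun n ψ hψ => hE.isNChain_homotopyOp hbgX eY hf hψ, fun ψ hψ => ?_, fun n ψ hψ => ?_⟩
  · obtain ⟨halt, ⟨R, -, hR⟩, -⟩ := hψ
    exact bdN_homotopyOp_zero _ halt (hE.finiteFibers_mixMap hbgX hR)
  · obtain ⟨halt, ⟨R, -, hR⟩, -⟩ := hψ
    exact bdN_homotopyOp_succ _ halt (hE.finiteFibers_mixMap hbgX hR) fun r =>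
      hbgX.finiteFibers hR _ (r 0) 0 fun x x' h => (dist_eq_zero.2 (congrFun h 0)).le
end
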